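/- arXiv:2007.09096 — 2 statements merged into one kernel-verified Lean document; each statement's English description precedes it below -/
import Mathlib

section
/- There exist constants h ≥ 1 and c ≥ 1 such that for every 2-TVASS V = (Q, Σ, Δ) and all states p, q with q ⇝ p, and all x, y ∈ ℕ with x, y ≥ (|Q| + ‖Σ‖)^h: if p(0, x) →* q(0, y), then there exists a linear path scheme L with |L| ≤ (|Q| + ‖Σ‖)^c and |L|_* = 1 such that p(0, x) →^L q(0, y). -/
namespace TVASSpaper

/-- Actions of a `d`-TVASS: `some a` is an addition of the vector `a ∈ ℤ^d`,
    `none` is the zero-test action `tst` (on the first counter). -/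
abbrev Act (d : ℕ) := Option (Fin d → ℤ)

/-- Transitions. -/
abbrev Trans (d : ℕ) (Q : Type) := Q × Act d × Q

/-- Configurations: a state together with a vector of `d` counters. -/
abbrev Config (d : ℕ) (Q : Type) := Q × (Fin d → ℕ)

/-- A `d`-TVASS: a finite set `acts` of actions and a finite set of transitions
    `trans ⊆ Q × acts × Q`. The state set `Q` is a (finite, nonempty) type. -/
structure TVASS (d : ℕ) (Q : Type) where
  acts : Finset (Act d)
  trans : Finset (Trans d Q)
  mem_acts : ∀ t ∈ trans, t.2.1 ∈ acts

variable {d : ℕ} {Q : Type}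

/-- The step induced by a single transition: an addition transition `(p, a, q)`
    induces `p(x) → q(x + a)` whenever `x + a ∈ ℕ^d`; a zero-test transition
    `(p, tst, q)` induces `p(x) → q(x)` whenever the first counter is `0`. -/
def StepBy [NeZero d] (t : Trans d Q) (c c' : Config d Q) : Prop :=
  t.1 = c.1 ∧ t.2.2 = c'.1 ∧
    match t.2.1 with
    | some a => ∀ i, (c'.2 i : ℤ) = (c.2 i : ℤ) + a i
    | none => c.2 0 = 0 ∧ c'.2 = c.2

/-- `Run V c π c'` : there is a run from `c` to `c'` taking the steps of the
    word of transitions `π` in order. -/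
inductive Run [NeZero d] (V : TVASS d Q) :
    Config d Q → List (Trans d Q) → Config d Q → Prop
  | nil (c : Config d Q) : Run V c [] c
  | cons {t : Trans d Q} {c c' c'' : Config d Q} {π : List (Trans d Q)} :
      t ∈ V.trans → StepBy t c c' → Run V c' π c'' → Run V c (t :: π) c''

/-- One step of the TVASS. -/
def Step [NeZero d] (V : TVASS d Q) (c c' : Config d Q) : Prop :=
  ∃ t ∈ V.trans, StepBy t c c'

/-- Reachability `c →* c'`. -/
def Reach [NeZero d] (V : TVASS d Q) (c c' : Config d Q) : Prop :=
  ∃ π, Run V c π c'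

/-- `IsPathFrom V p π q` : `π` is a path (word of transitions of `V` with
    matching endpoints) from state `p` to state `q`. -/
inductive IsPathFrom (V : TVASS d Q) : Q → List (Trans d Q) → Q → Prop
  | nil (p : Q) : IsPathFrom V p [] p
  | cons {t : Trans d Q} {π : List (Trans d Q)} {q : Q} :
      t ∈ V.trans → IsPathFrom V t.2.2 π q → IsPathFrom V t.1 (t :: π) q

/-- `n`-fold concatenation of a word. -/
def pw {α : Type*} (l : List α) (n : ℕ) : List α := (List.replicate n l).flatten

/-- A linear path scheme `α₀ β₁* α₁ ⋯ β_k* α_k`, given by the head path `α₀`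
    and the list of pairs `(β₁, α₁), …, (β_k, α_k)`. -/
structure LPS (d : ℕ) (Q : Type) where
  head : List (Trans d Q)
  rest : List (List (Trans d Q) × List (Trans d Q))

/-- Length `|L|` of a linear path scheme. -/
def LPS.len (L : LPS d Q) : ℕ :=
  L.head.length + (L.rest.map fun p => p.1.length + p.2.length).sum

/-- Number of stars `|L|_*` of a linear path scheme. -/
def LPS.stars (L : LPS d Q) : ℕ := L.rest.length

def wordRest : List (List (Trans d Q) × List (Trans d Q)) → List ℕ → List (Trans d Q)
  | [], _ => []
  | p :: rest, ns => pw p.1 (ns.headD 0) ++ p.2 ++ wordRest rest ns.tail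

/-- The word `α₀ β₁^{n₁} α₁ ⋯ β_k^{n_k} α_k` of `L` for exponents `ns`. -/
def LPS.word (L : LPS d Q) (ns : List ℕ) : List (Trans d Q) :=
  L.head ++ wordRest L.rest ns

/-- Well-formedness of the tail of a linear path scheme starting in state `s`:
    the `βᵢ` are cycles and the `αᵢ` are paths, with matching endpoints. -/
inductive ChainLPS (V : TVASS d Q) :
    Q → List (List (Trans d Q) × List (Trans d Q)) → Q → Prop
  | nil (q : Q) : ChainLPS V q [] q
  | cons {s s' q : Q} {β α : List (Trans d Q)}
      {rest : List (List (Trans d Q) × List (Trans d Q))} :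
      IsPathFrom V s β s → IsPathFrom V s α s' → ChainLPS V s' rest q →
      ChainLPS V s ((β, α) :: rest) q

/-- `L` is a genuine linear path scheme from `p` to `q` in `V`. -/
def IsLPS (V : TVASS d Q) (p : Q) (L : LPS d Q) (q : Q) : Prop :=
  ∃ s, IsPathFrom V p L.head s ∧ ChainLPS V s L.rest q

/-- `c →^L c'` : reachability along the linear path scheme `L`. -/
def ReachLPS [NeZero d] (V : TVASS d Q) (L : LPS d Q) (c c' : Config d Q) : Prop :=
  ∃ ns, Run V c (L.word ns) c'

/-- `‖x⃗‖`: maximum component of a vector of naturals. -/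
def vnorm {d : ℕ} (v : Fin d → ℕ) : ℕ := Finset.univ.sup v

/-- Maximum absolute value of a component of an integer vector. -/
def vnormZ {d : ℕ} (v : Fin d → ℤ) : ℕ := Finset.univ.sup fun i => (v i).natAbs

/-- `‖Σ‖`: maximum absolute value of a component of a vector in `Σ ∖ {tst}`
    (0 if `Σ ⊆ {tst}`). -/
def TVASS.actNorm (V : TVASS d Q) : ℕ :=
  V.acts.sup fun a => a.elim 0 vnormZ

/-- Displacement of a word of transitions (zero-tests contribute `0`). -/
def disp (π : List (Trans d Q)) : Fin d → ℤ :=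
  fun i => (π.map fun t => (t.2.1.elim 0 id : Fin d → ℤ) i).sum

/-- `m_π(i)`: max over prefixes `α` of `π` (including the empty prefix) of `-Δ(α)(i)`. -/
def mpre (π : List (Trans d Q)) (i : Fin d) : ℤ :=
  (π.inits.map fun α => -(disp α i)).foldr max 0

/-- `m_π̄(i)`: max over suffixes `σ` of `π` (including the empty suffix) of `Δ(σ)(i)`. -/
def msuf (π : List (Trans d Q)) (i : Fin d) : ℤ :=
  (π.tails.map fun σ => disp σ i).foldr max 0

/-- `π` contains no zero-test transition. -/
def noTst (π : List (Trans d Q)) : Prop := ∀ t ∈ π, t.2.1 ≠ none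

/-- `x⃗ ≥₁ m⃗` : `x⃗(1) = m⃗(1)` and `x⃗(i) ≥ m⃗(i)` for all other `i`. -/
def ge1 [NeZero d] (x : Fin d → ℕ) (m : Fin d → ℤ) : Prop :=
  (x 0 : ℤ) = m 0 ∧ ∀ i : Fin d, i ≠ 0 → m i ≤ (x i : ℤ)

/-- A path from `p` to `q` is feasible if some run takes it. -/
def Feasible [NeZero d] (V : TVASS d Q) (p : Q) (π : List (Trans d Q)) (q : Q) : Prop :=
  ∃ x y, Run V (p, x) π (q, y)

/-- `c →^{A* ∪ T} c'` : there is a run from `c` to `c'` whose path either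
    contains no zero-test transition, or is a single zero-test transition. -/
def ReachAT [NeZero d] (V : TVASS d Q) (c c' : Config d Q) : Prop :=
  ∃ π, Run V c π c' ∧ (noTst π ∨ ∃ t : Trans d Q, π = [t] ∧ t.2.1 = none)

/-- `p ⇝ q` for a 2-TVASS: `p(0, x) →* q(0, y)` for some `x, y ∈ ℕ`. -/
def Leads (V : TVASS 2 Q) (p q : Q) : Prop :=
  ∃ x y : ℕ, Reach V (p, ![0, x]) (q, ![0, y])

/-- The linear path scheme `L` is bounded from the configuration `c`: the set of
    configurations reachable from `c` along a prefix of a path in `L` is finite. -/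
def BoundedLPS [NeZero d] (V : TVASS d Q) (L : LPS d Q) (c : Config d Q) : Prop :=
  {c' : Config d Q | ∃ ns ρ, ρ <+: L.word ns ∧ Run V c ρ c'}.Finite

/-- Edges of a weighted one-counter automaton with state set `K`:
    `E s b a w t` is an edge from `s` to `t` with counter effect `a` and weight `w`,
    which tests the counter for zero iff `b = true`. -/
abbrev OCEdges (K : Type) := K → Bool → ℤ → ℤ → K → Prop

/-- `OCRun E n w s x t y`: a run of length `n` and weight `w` from `s(x)` to `t(y)`. -/
inductive OCRun {K : Type} (E : OCEdges K) : ℕ → ℤ → K → ℕ → K → ℕ → Prop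
  | nil (s : K) (x : ℕ) : OCRun E 0 0 s x s x
  | cons {s t u : K} {b : Bool} {a w w' : ℤ} {n x y z : ℕ} :
      E s b a w t → (y : ℤ) = x + a → (b = true → x = 0 ∧ y = 0) →
      OCRun E n w' t y u z → OCRun E (n + 1) (w + w') s x u z

/-- The edges that are not zero-tests. -/
def testFree {K : Type} (E : OCEdges K) : OCEdges K :=
  fun s b a w t => b = false ∧ E s b a w t

/-- All counter effects and weights have absolute value at most `T`. -/
def EdgesBdd {K : Type} (E : OCEdges K) (T : ℕ) : Prop :=
  ∀ s b a w t, E s b a w t → |a| ≤ T ∧ |w| ≤ T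

theorem EdgesBdd.mono {K : Type} {E : OCEdges K} {T T' : ℕ} (hE : EdgesBdd E T) (h : T ≤ T') :
    EdgesBdd E T' :=
  fun s b a w t he => ⟨(hE s b a w t he).1.trans (by exact_mod_cast h),
    (hE s b a w t he).2.trans (by exact_mod_cast h)⟩

namespace OCRun

variable {K : Type} {E : OCEdges K}

theorem cast {n n' : ℕ} {w w' : ℤ} {s t : K} {x x' y y' : ℕ} (h : OCRun E n w s x t y)
    (hn : n = n') (hw : w = w') (hx : x = x') (hy : y = y') : OCRun E n' w' s x' t y' := by
  subst hn hw hx hy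
  exact h

theorem map {K' : Type} {E' : OCEdges K'} (f : K → K')
    (hf : ∀ s b a w t, E s b a w t → E' (f s) b a w (f t)) {n : ℕ} {w : ℤ} {s t : K} {x y : ℕ}
    (h : OCRun E n w s x t y) : OCRun E' n w (f s) x (f t) y := by
  induction h with
  | nil s x => exact .nil _ _
  | cons he hy hb _ ih => exact .cons (hf _ _ _ _ _ he) hy hb ih

theorem of_testFree {n : ℕ} {w : ℤ} {s t : K} {x y : ℕ} (h : OCRun (testFree E) n w s x t y) :
    OCRun E n w s x t y :=
  h.map id fun _ _ _ _ _ he => he.2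

theorem append {n n' : ℕ} {w w' : ℤ} {s t u : K} {x y z : ℕ} (h : OCRun E n w s x t y)
    (h' : OCRun E n' w' t y u z) : OCRun E (n + n') (w + w') s x u z := by
  induction h with
  | nil s x => simpa using h'
  | cons he hy hb _ ih => exact (OCRun.cons he hy hb (ih h')).cast (by omega) (by ring) rfl rfl

theorem iterate {n : ℕ} {w : ℤ} {s : K} {x : ℕ} (h : OCRun E n w s x s x) (k : ℕ) :
    OCRun E (k * n) (k * w) s x s x := by
  induction k with
  | zero => exact (OCRun.nil s x).cast (by simp) (by simp) rfl rfl
  | succ k ih => exact (ih.append h).cast (by ring) (by push_cast; ring) rfl rfl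

theorem lift {n : ℕ} {w : ℤ} {s t : K} {x y : ℕ} (h : OCRun (testFree E) n w s x t y) (d : ℕ) :
    OCRun (testFree E) n w s (x + d) t (y + d) := by
  induction h with
  | nil s x => exact .nil _ _
  | cons he hy hb _ ih =>
    refine .cons he (by push_cast; omega) (fun h => ?_) ih
    simp [he.1] at h

theorem iterate_up {n : ℕ} {w : ℤ} {s : K} {x D : ℕ}
    (h : OCRun (testFree E) n w s x s (x + D)) (k : ℕ) :
    OCRun (testFree E) (k * n) (k * w) s x s (x + k * D) := by
  induction k with
  | zero => exact (OCRun.nil s x).cast (by simp) (by simp) rfl (by simp)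
  | succ k ih =>
    exact (ih.append (h.lift (k * D))).cast (by ring) (by push_cast; ring) rfl (by ring)

theorem iterate_down {n : ℕ} {w : ℤ} {s : K} {x D : ℕ}
    (h : OCRun (testFree E) n w s (x + D) s x) (k : ℕ) :
    OCRun (testFree E) (k * n) (k * w) s (x + k * D) s x := by
  induction k with
  | zero => exact (OCRun.nil s x).cast (by simp) (by simp) (by simp) rfl
  | succ k ih =>
    exact ((h.lift (k * D)).append ih).cast (by ring) (by push_cast; ring) (by ring) rfl

theorem abs_weight_le {T : ℕ} (hE : EdgesBdd E T) {n : ℕ} {w : ℤ} {s t : K} {x y : ℕ}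
    (h : OCRun E n w s x t y) : |w| ≤ n * T := by
  induction h with
  | nil s x => simp
  | @cons _ _ _ _ _ w w' _ _ _ _ he _ _ _ ih =>
    have := (hE _ _ _ _ _ he).2
    have := abs_add_le w w'
    push_cast
    linarith

/-- A short run that starts high contains no zero-tests and can be translated. -/
theorem translate {T : ℕ} (hE : EdgesBdd E T) {n : ℕ} {w : ℤ} {s t : K} {x y : ℕ}
    (h : OCRun E n w s x t y) {x' : ℕ} (hx : n * T < x) (hx' : n * T < x') :
    ∃ y', y' + x = x' + y ∧ OCRun (testFree E) n w s x' t y' := by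
  induction h generalizing x' with
  | nil s x => exact ⟨x', rfl, .nil _ _⟩
  | @cons _ _ _ b a w w' n x y z he hy hb _ ih =>
    have ha := abs_le.1 (hE _ _ _ _ _ he).1
    rw [add_mul, one_mul] at hx hx'
    obtain ⟨y', hy', h'⟩ := @ih (x' + a).toNat (by omega) (by omega)
    refine ⟨y', by omega, .cons ⟨?_, he⟩ (by omega) (fun hb' => ?_) h'⟩
    · by_contra hb'
      have := hb (by simpa using hb')
      omega
    · have := hb hb'
      omega

end OCRun

/-- States, counter values and accumulated weights along a run of length `n`. -/
def IsTrace {K : Type} (E : OCEdges K) (n : ℕ) (st : ℕ → K) (ht : ℕ → ℕ) (wt : ℕ → ℤ) : Prop :=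
  ∀ k < n, ∃ b a, E (st k) b a (wt (k + 1) - wt k) (st (k + 1)) ∧
    (ht (k + 1) : ℤ) = ht k + a ∧ (b = true → ht k = 0 ∧ ht (k + 1) = 0)

theorem OCRun.exists_trace {K : Type} {E : OCEdges K} {n : ℕ} {w : ℤ} {s t : K} {x y : ℕ}
    (h : OCRun E n w s x t y) : ∃ st ht wt, IsTrace E n st ht wt ∧
      st 0 = s ∧ ht 0 = x ∧ wt 0 = 0 ∧ st n = t ∧ ht n = y ∧ wt n = w := by
  induction h with
  | nil s x => exact ⟨fun _ => s, fun _ => x, fun _ => 0, by simp [IsTrace]⟩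
  | @cons s _ _ b a w _ _ x _ _ he hy hb _ ih =>
    obtain ⟨st, ht, wt, htr, h0, h1, h2, h3, h4, h5⟩ := ih
    refine ⟨fun k => k.casesOn s st, fun k => k.casesOn x ht, fun k => k.casesOn 0 (w + wt ·),
      ?_, rfl, rfl, rfl, h3, h4, by simp [h5]⟩
    rintro (_ | k) hk
    · refine ⟨b, a, ?_, ?_, ?_⟩
      · simpa [h0, h2] using he
      · simpa [h1] using hy
      · simpa [h1] using hb
    · obtain ⟨b, a, h⟩ := htr k (by omega)
      exact ⟨b, a, by simpa using h⟩

namespace IsTrace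

variable {K : Type} {E : OCEdges K} {n : ℕ} {st : ℕ → K} {ht : ℕ → ℕ} {wt : ℕ → ℤ}

theorem run (h : IsTrace E n st ht wt) {i j : ℕ} (hij : i ≤ j) (hj : j ≤ n) :
    OCRun E (j - i) (wt j - wt i) (st i) (ht i) (st j) (ht j) := by
  induction j, hij using Nat.le_induction with
  | base => exact (OCRun.nil _ _).cast (by simp) (by simp) rfl rfl
  | succ j hij ih =>
    obtain ⟨b, a, he, hy, hb⟩ := h j (by omega)
    exact ((ih (by omega)).append (.cons he hy hb (.nil _ _))).cast (by omega) (by ring) rfl rfl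

/-- A segment of a run that stays above `d` and performs no zero-test can be lowered by `d`. -/
theorem run_sub (h : IsTrace E n st ht wt) {i j d : ℕ} (hij : i ≤ j) (hj : j ≤ n)
    (hd : ∀ k, i ≤ k → k ≤ j → d ≤ ht k) (hpos : ∀ k, i ≤ k → k < j → 0 < ht k ∨ 0 < ht (k + 1)) :
    OCRun (testFree E) (j - i) (wt j - wt i) (st i) (ht i - d) (st j) (ht j - d) := by
  induction j, hij using Nat.le_induction with
  | base => exact (OCRun.nil _ _).cast (by simp) (by simp) rfl rfl
  | succ j hij ih =>
    obtain ⟨b, a, he, hy, hb⟩ := h j (by omega)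
    have hb' : b = false := by
      by_contra hb'
      have := hb (by simpa using hb')
      have := hpos j hij (by omega)
      omega
    have h1 := hd j hij (by omega)
    have h2 := hd (j + 1) (by omega) le_rfl
    have ih := ih (by omega) (fun k h1 h2 => hd k h1 (by omega))
      (fun k h1 h2 => hpos k h1 (by omega))
    refine (ih.append (.cons ⟨hb', he⟩ (y := ht (j + 1) - d) (by omega) (by simp [hb'])
      (.nil _ _))).cast (by omega) (by ring) rfl rfl

end IsTrace

section Combinatorics

theorem exists_last_le {ht : ℕ → ℕ} {l P : ℕ} (h0 : ht 0 ≤ l) (hP : l < ht P) :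
    ∃ i < P, ht i ≤ l ∧ ∀ k, i < k → k ≤ P → l < ht k := by
  induction P with
  | zero => omega
  | succ P ih =>
    by_cases h : ht P ≤ l
    · refine ⟨P, by omega, h, fun k h1 h2 => ?_⟩
      obtain rfl : k = P + 1 := by omega
      exact hP
    · obtain ⟨i, hi, h1, h2⟩ := ih (by omega)
      refine ⟨i, by omega, h1, fun k h3 h4 => ?_⟩
      rcases Nat.lt_or_ge P k with h5 | h5
      · obtain rfl : k = P + 1 := by omega
        exact hP
      · exact h2 k h3 h5

theorem exists_first_le {ht : ℕ → ℕ} {l P n : ℕ} (hPn : P ≤ n) (hn : ht n ≤ l) (hP : l < ht P) :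
    ∃ j, P < j ∧ j ≤ n ∧ ht j ≤ l ∧ ∀ k, P ≤ k → k < j → l < ht k := by
  classical
  have hex : ∃ j, P ≤ j ∧ ht j ≤ l := ⟨n, hPn, hn⟩
  obtain ⟨h1, h2⟩ := Nat.find_spec hex
  refine ⟨Nat.find hex, lt_of_le_of_ne h1 ?_, Nat.find_min' hex ⟨hPn, hn⟩, h2, fun k h3 h4 => ?_⟩
  · intro h
    rw [← h] at h2
    omega
  · have := Nat.find_min hex h4
    omega

theorem exists_repeat {K : Type} [Fintype K] {st : ℕ → K} {ht : ℕ → ℕ} {a lo D L : ℕ}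
    (hD : ∀ k, a ≤ k → k ≤ a + L → lo ≤ ht k ∧ ht k ≤ lo + D)
    (hL : Fintype.card K * (D + 1) ≤ L) :
    ∃ i j, a ≤ i ∧ i < j ∧ j ≤ a + L ∧ st i = st j ∧ ht i = ht j := by
  have hcard : Fintype.card (K × Fin (D + 1)) < Fintype.card (Fin (L + 1)) := by
    simp only [Fintype.card_prod, Fintype.card_fin]
    omega
  obtain ⟨i, j, hij, h⟩ := Fintype.exists_ne_map_eq_of_card_lt
    (fun k : Fin (L + 1) => (st (a + k), (⟨ht (a + k) - lo, by
      have := hD (a + k) (by omega) (by omega)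
      omega⟩ : Fin (D + 1)))) hcard
  simp only [Prod.mk.injEq, Fin.mk.injEq] at h
  have h1 := hD (a + i) (by omega) (by omega)
  have h2 := hD (a + j) (by omega) (by omega)
  rcases lt_or_gt_of_ne hij with hlt | hlt
  · exact ⟨a + i, a + j, by omega, by simpa using hlt, by omega, h.1, by omega⟩
  · exact ⟨a + j, a + i, by omega, by simpa using hlt, by omega, h.1.symm, by omega⟩

/-- A long sequence of labelled heights with bounded increments contains a short cut:
    either a repetition, or a pair of matching repetitions on the two sides of a peak. -/
theorem exists_cut {K : Type} [Fintype K] {T n : ℕ} (hT : 2 ≤ T) (hK : Fintype.card K ≤ T)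
    {st : ℕ → K} {ht : ℕ → ℕ} (hstep : ∀ k < n, ht (k + 1) ≤ ht k + T ∧ ht k ≤ ht (k + 1) + T)
    (h0 : ht 0 ≤ T) (hn : ht n ≤ T) (hlen : T ^ 7 ≤ n) :
    (∃ i j, i < j ∧ j ≤ n ∧ j ≤ i + T ^ 7 ∧ st i = st j ∧ ht i = ht j) ∨
    ∃ i i' j' j, i < i' ∧ i' < j' ∧ j' < j ∧ j ≤ n ∧ j ≤ i + T ^ 7 ∧
      st i = st i' ∧ st j' = st j ∧ ht i < ht i' ∧ ht i' + ht j = ht j' + ht i ∧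
      (∀ k, i < k → k < j → ht i < ht k ∧ ht j < ht k) ∧
      (∀ k, i' < k → k < j' → ht i' ≤ ht k) := by
  have hbound : Fintype.card K * (T ^ 4 + T + 2 + 1) ≤ T ^ 7 := by
    have h1 : T * T ≤ T ^ 4 := by
      calc T * T = T ^ 2 := by ring
        _ ≤ T ^ 4 := Nat.pow_le_pow_right (by omega) (by omega)
    have h2 : T + 2 + 1 ≤ T * T + 1 := by nlinarith
    have h3 : 1 ≤ T ^ 4 := Nat.one_le_pow _ _ (by omega)
    have h4 : T ^ 4 + T + 2 + 1 ≤ T * (T * T ^ 4) := by nlinarith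
    calc Fintype.card K * (T ^ 4 + T + 2 + 1) ≤ T * (T * (T * T ^ 4)) := Nat.mul_le_mul hK h4
      _ = T ^ 7 := by ring
  refine or_iff_not_imp_left.2 fun hno => ?_
  push Not at hno
  obtain ⟨P, hP, hmax⟩ := Finset.exists_max_image (Finset.range (n + 1)) ht (by simp)
  simp only [Finset.mem_range, Nat.lt_succ_iff] at hP hmax
  have hM : T ^ 4 + T + 2 < ht P := by
    by_contra hM
    obtain ⟨i, j, _, h2, h3, h4, h5⟩ := exists_repeat (st := st) (ht := ht) (a := 0) (lo := 0)
      (D := T ^ 4 + T + 2) (L := T ^ 7) (fun k _ hk => ⟨by omega, by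
        have := hmax k (by omega)
        omega⟩) hbound
    exact hno i j h2 (by omega) (by omega) h4 h5
  have hlev : ∀ r : Fin (T ^ 4 + 1), ∃ i j, i < P ∧ P < j ∧ j ≤ n ∧
      ht i ≤ ht P - 1 - r ∧ ht j ≤ ht P - 1 - r ∧
      (∀ k, i < k → k < j → ht P - 1 - r < ht k) ∧
      ht P - 1 - r < ht i + T ∧ ht P - 1 - r < ht j + T := by
    intro r
    have hr := r.isLt
    obtain ⟨i, hi, h1, h2⟩ := exists_last_le (ht := ht) (l := ht P - 1 - r) (P := P)
      (by omega) (by omega)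
    obtain ⟨j, hj, hjn, h3, h4⟩ := exists_first_le (ht := ht) (l := ht P - 1 - r) hP
      (by omega) (by omega)
    refine ⟨i, j, hi, hj, hjn, h1, h3, fun k hk hk' => ?_, ?_, ?_⟩
    · rcases le_total k P with h | h
      · exact h2 k hk h
      · exact h4 k h hk'
    · have := hstep i (by omega)
      have := h2 (i + 1) (by omega) (by omega)
      omega
    · have := hstep (j - 1) (by omega)
      have := h4 (j - 1) (by omega) (by omega)
      rw [show j - 1 + 1 = j by omega] at *
      omega
  choose I J hI hJ hJn hIl hJl hIJ hIT hJT using hlev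
  have hwin : J (Fin.last _) ≤ I (Fin.last _) + T ^ 7 := by
    by_contra hwin
    obtain ⟨i, j, h1, h2, h3, h4, h5⟩ := exists_repeat (st := st) (ht := ht)
      (a := I (Fin.last _)) (lo := ht P - T ^ 4 - T - 1)
      (D := T ^ 4 + T + 2) (L := T ^ 7) (fun k hk hk' => by
        have h1 := hmax k (by have := hJn (Fin.last _); omega)
        have h2 := hIT (Fin.last _)
        have h3 := hIJ (Fin.last _) k
        simp only [Fin.val_last] at h2 h3
        rcases hk.eq_or_lt with rfl | hk
        · omega
        · have := h3 hk (by omega)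
          omega) hbound
    exact hno i j h2 (by have := hJn (Fin.last _); omega) (by omega) h4 h5
  have hmono : ∀ r r' : Fin (T ^ 4 + 1), r ≤ r' → I r' ≤ I r ∧ J r ≤ J r' := by
    intro r r' h
    have h' : (r : ℕ) ≤ r' := h
    constructor
    · by_contra hlt
      have := hIJ r (I r') (by omega) (by have := hI r'; have := hJ r; omega)
      have := hIl r'
      omega
    · by_contra hlt
      have := hIJ r (J r') (by have := hI r; have := hJ r'; omega) (by omega)
      have := hJl r'
      omega
  have hcard : Fintype.card ((K × Fin T) × (K × Fin T)) < Fintype.card (Fin (T ^ 4 + 1)) := by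
    simp only [Fintype.card_prod, Fintype.card_fin]
    have h1 : Fintype.card K * T ≤ T * T := Nat.mul_le_mul_right _ hK
    have h2 := Nat.mul_le_mul h1 h1
    have h3 : T * T * (T * T) = T ^ 4 := by ring
    omega
  obtain ⟨r, r', hne, heq⟩ := Fintype.exists_ne_map_eq_of_card_lt
    (fun r : Fin (T ^ 4 + 1) =>
      ((st (I r), (⟨ht P - 1 - r - ht (I r), by have := hIT r; omega⟩ : Fin T)),
        (st (J r), (⟨ht P - 1 - r - ht (J r), by have := hJT r; omega⟩ : Fin T)))) hcard
  wlog hlt : r' < r generalizing r r'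
  · exact this r' r hne.symm heq.symm (lt_of_le_of_ne (not_lt.1 hlt) hne)
  simp only [Prod.mk.injEq, Fin.mk.injEq] at heq
  obtain ⟨⟨e1, e2⟩, e3, e4⟩ := heq
  have hlt' : (r' : ℕ) < r := hlt
  have hr := r.isLt
  have hm := hmono r' r hlt.le
  have hml := hmono r (Fin.last _) (Fin.le_last _)
  have a1 := hIl r
  have a2 := hIl r'
  have a3 := hJl r
  have a4 := hJl r'
  have hi : ht (I r) < ht (I r') := by omega
  have hj : ht (J r) < ht (J r') := by omega
  refine ⟨I r, I r', J r', J r, lt_of_le_of_ne hm.1 ?_, (hI r').trans (hJ r'),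
    lt_of_le_of_ne hm.2 ?_, hJn r, by omega, e1, e3.symm, hi, by omega, ?_, ?_⟩
  · intro h
    rw [h] at hi
    omega
  · intro h
    rw [h] at hj
    omega
  · intro k h1 h2
    have := hIJ r k h1 h2
    omega
  · intro k h1 h2
    have := hIJ r' k h1 h2
    omega

end Combinatorics

/-- A long run contains a short cut: either a cycle, or a pair of test-free segments
    of opposite counter effects around a test-free segment that can be lowered. -/
theorem OCRun.exists_cut {K : Type} [Fintype K] {E : OCEdges K} {T : ℕ} (hT : 2 ≤ T)
    (hK : Fintype.card K ≤ T) (hE : EdgesBdd E T) {n : ℕ} {w : ℤ} {p q : K} {x y : ℕ}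
    (hx : x ≤ T) (hy : y ≤ T) (hn : T ^ 7 ≤ n) (h : OCRun E n w p x q y) :
    (∃ s z n₁ n₂ n₃ w₁ w₂ w₃, OCRun E n₁ w₁ p x s z ∧ OCRun E n₂ w₂ s z s z ∧
      OCRun E n₃ w₃ s z q y ∧ 0 < n₂ ∧ n₂ ≤ T ^ 7 ∧ n = n₁ + n₂ + n₃ ∧ w = w₁ + w₂ + w₃) ∨
    ∃ s t z z' D n₁ n₂ n₃ n₄ n₅ w₁ w₂ w₃ w₄ w₅, OCRun E n₁ w₁ p x s z ∧
      OCRun (testFree E) n₂ w₂ s 0 s (0 + D) ∧ OCRun (testFree E) n₃ w₃ s z t z' ∧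
      OCRun (testFree E) n₄ w₄ t (0 + D) t 0 ∧ OCRun E n₅ w₅ t z' q y ∧ 0 < n₂ ∧
      n₂ + n₄ ≤ T ^ 7 ∧ n = n₁ + n₂ + n₃ + n₄ + n₅ ∧ w = w₁ + w₂ + w₃ + w₄ + w₅ := by
  obtain ⟨st, ht, wt, htr, rfl, rfl, h0, rfl, rfl, rfl⟩ := h.exists_trace
  have hstep : ∀ k < n, ht (k + 1) ≤ ht k + T ∧ ht k ≤ ht (k + 1) + T := by
    intro k hk
    obtain ⟨b, a, he, ha, -⟩ := htr k hk
    have := abs_le.1 (hE _ _ _ _ _ he).1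
    omega
  rcases TVASSpaper.exists_cut (st := st) hT hK hstep hx hy hn with
    ⟨i, j, hij, hj, hl, hst, hht⟩ |
    ⟨i, i', j', j, h1, h2, h3, hj, hl, hs, hs', hlt, heq, hab, hab'⟩
  · left
    have hv := htr.run hij.le hj
    have hz := htr.run hj le_rfl
    rw [← hst, ← hht] at hv hz
    refine ⟨st i, ht i, _, _, _, _, _, _, htr.run (Nat.zero_le i) (by omega), hv, hz,
      by omega, by omega, by omega, ?_⟩
    rw [h0]
    ring
  · right
    have hv := htr.run_sub (i := i) (j := i') (d := ht i) h1.le (by omega)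
      (fun k hk hk' => by
        rcases hk.eq_or_lt with rfl | hk
        · exact le_rfl
        · exact (hab k hk (by omega)).1.le)
      (fun k hk hk' => .inr (by have := hab (k + 1) (by omega) (by omega); omega))
    have hx := htr.run_sub (i := i') (j := j') (d := ht i' - ht i) h2.le (by omega)
      (fun k hk hk' => by
        rcases hk.eq_or_lt with rfl | hk
        · omega
        · rcases hk'.eq_or_lt with rfl | hk'
          · omega
          · have := hab' k hk hk'
            omega)
      (fun k hk hk' => .inr (by have := hab (k + 1) (by omega) (by omega); omega))
    have hy := htr.run_sub (i := j') (j := j) (d := ht j) h3.le hj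
      (fun k hk hk' => by
        rcases hk'.eq_or_lt with rfl | hk'
        · exact le_rfl
        · exact (hab k (by omega) hk').2.le)
      (fun k hk hk' => .inl (by have := hab k (by omega) (by omega); omega))
    rw [← hs] at hv hx
    rw [hs'] at hx hy
    refine ⟨st i, st j, ht i, ht j, ht i' - ht i, _, _, _, _, _, _, _, _, _, _,
      htr.run (Nat.zero_le i) (by omega), hv.cast rfl rfl (by omega) (by omega),
      hx.cast rfl rfl (by omega) (by omega), hy.cast rfl rfl (by omega) (by omega),
      htr.run hj le_rfl, by omega, by omega, by omega, ?_⟩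
    rw [h0]
    ring

/-- A long run can be shortened, and the removed weight can be pumped. -/
theorem OCRun.exists_shorter {K : Type} [Fintype K] {E : OCEdges K} {T : ℕ} (hT : 2 ≤ T)
    (hK : Fintype.card K ≤ T) (hE : EdgesBdd E T) {n : ℕ} {w : ℤ} {p q : K} {x y : ℕ}
    (hx : x ≤ T) (hy : y ≤ T) (hn : T ^ 7 ≤ n) (h : OCRun E n w p x q y) :
    ∃ δ : ℤ, (∃ n' < n, OCRun E n' (w - δ) p x q y) ∧
      ∀ k : ℕ, ∃ n', OCRun E n' (w - δ + k * δ) p x q y := by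
  rcases h.exists_cut hT hK hE hx hy hn with
    ⟨s, z, n₁, n₂, n₃, w₁, w₂, w₃, hu, hv, hz, hpos, -, rfl, rfl⟩ |
    ⟨s, t, z, z', D, n₁, n₂, n₃, n₄, n₅, w₁, w₂, w₃, w₄, w₅, hu, hv, hm, hv', hz, hpos, -,
      rfl, rfl⟩
  · refine ⟨w₂, ⟨n₁ + n₃, by omega, (hu.append hz).cast rfl (by ring) rfl rfl⟩, fun k => ?_⟩
    exact ⟨_, ((hu.append (hv.iterate k)).append hz).cast rfl (by ring) rfl rfl⟩
  · refine ⟨w₂ + w₄, ⟨n₁ + n₃ + n₅, by omega,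
      ((hu.append hm.of_testFree).append hz).cast rfl (by ring) rfl rfl⟩, fun k => ?_⟩
    have h1 := ((hv.iterate_up k).lift z).of_testFree
    have h2 := (hm.lift (k * D)).of_testFree
    have h3 := ((hv'.iterate_down k).lift z').of_testFree
    exact ⟨_, ((((hu.append (h1.cast rfl rfl (by omega) rfl)).append
      (h2.cast rfl rfl (by omega) rfl)).append (h3.cast rfl rfl (by omega) (by omega))).append
      hz).cast rfl (by ring) rfl rfl⟩

theorem OCRun.exists_short {K : Type} [Fintype K] {E : OCEdges K} {T : ℕ} (hT : 2 ≤ T)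
    (hK : Fintype.card K ≤ T) (hE : EdgesBdd E T) {n : ℕ} {w : ℤ} {p q : K} {x y : ℕ}
    (hx : x ≤ T) (hy : y ≤ T) (h : OCRun E n w p x q y) :
    ∃ n' w', n' ≤ T ^ 7 ∧ OCRun E n' w' p x q y := by
  induction n using Nat.strong_induction_on generalizing w with
  | _ n ih =>
    rcases le_total n (T ^ 7) with hn | hn
    · exact ⟨n, w, hn, h⟩
    · obtain ⟨δ, ⟨n', hn', h'⟩, -⟩ := h.exists_shorter hT hK hE hx hy hn
      exact ih n' hn' h'

section Residues

/-- Edges extended by the residue modulo `m` of the weight accumulated so far. -/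
def residueEdges {K : Type} (E : OCEdges K) (m : ℕ) : OCEdges (K × ZMod m) :=
  fun s b a w t => E s.1 b a w t.1 ∧ t.2 = s.2 + w

theorem OCRun.to_residue {K : Type} {E : OCEdges K} (m : ℕ) {n : ℕ} {w : ℤ} {s t : K} {x y : ℕ}
    (h : OCRun E n w s x t y) (r : ZMod m) :
    OCRun (residueEdges E m) n w (s, r) x (t, r + w) y := by
  induction h generalizing r with
  | nil s x => simpa using OCRun.nil _ _
  | @cons _ t _ b a w w' _ _ _ _ he hy hb _ ih =>
    have := OCRun.cons (E := residueEdges E m) (s := (_, r)) (t := (t, r + w)) ⟨he, rfl⟩ hy hb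
      (ih (r + w))
    simpa [add_assoc] using this

theorem OCRun.residue_eq {K : Type} {E : OCEdges K} {m : ℕ} {n : ℕ} {w : ℤ} {s t : K × ZMod m}
    {x y : ℕ} (h : OCRun (residueEdges E m) n w s x t y) : t.2 = s.2 + w := by
  induction h with
  | nil s x => simp
  | cons he _ _ _ ih => rw [ih, he.2]; push_cast; ring

/-- Runs can be shortened while preserving the weight modulo `m`; if weights of cycles are
    nonnegative, then the weight does not increase. -/
theorem OCRun.exists_short_modEq {K : Type} [Fintype K] {E : OCEdges K} {T : ℕ} (hT : 2 ≤ T)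
    {m : ℕ} (hm : 0 < m) (hK : Fintype.card K * m ≤ T) (hE : EdgesBdd E T) {n : ℕ} {w : ℤ}
    {p q : K} (h : OCRun E n w p 0 q 0) :
    ∃ n' w', n' ≤ T ^ 7 ∧ (m : ℤ) ∣ w - w' ∧ OCRun E n' w' p 0 q 0 ∧
      ∀ nr wr, OCRun E nr wr q 0 p 0 → (∀ n w, OCRun E n w p 0 p 0 → 0 ≤ w) → w' ≤ w := by
  have : NeZero m := ⟨hm.ne'⟩
  induction n using Nat.strong_induction_on generalizing w with
  | _ n ih =>
    rcases le_total n (T ^ 7) with hn | hn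
    · exact ⟨n, w, hn, by simp, h, fun _ _ _ _ => le_rfl⟩
    · have hproj : ∀ {n w s t}, OCRun (residueEdges E m) n w s 0 t 0 → OCRun E n w s.1 0 t.1 0 :=
        fun h => h.map Prod.fst fun _ _ _ _ _ he => he.1
      obtain ⟨δ, ⟨n', hn', h'⟩, hpump⟩ := (h.to_residue m 0).exists_shorter hT
        (by simpa [ZMod.card] using hK) (fun s b a w t he => hE _ _ _ _ _ he.1)
        (Nat.zero_le _) (Nat.zero_le _) hn
      have hδ : (m : ℤ) ∣ δ := by
        have := h'.residue_eq
        rw [← ZMod.intCast_zmod_eq_zero_iff_dvd]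
        push_cast at this
        linear_combination this
      obtain ⟨n₀, w₀, hn₀, hdvd, h₀, hle⟩ := ih n' hn' (hproj h')
      refine ⟨n₀, w₀, hn₀, ?_, h₀, fun nr wr hr hnn => ?_⟩
      · have := dvd_add hdvd hδ
        rwa [show w - δ - w₀ + δ = w - w₀ by ring] at this
      · have hle := hle nr wr hr hnn
        suffices 0 ≤ δ by omega
        by_contra hneg
        obtain ⟨n₁, h₁⟩ := hpump ((w - δ + wr).toNat + 1)
        have := hnn _ _ ((hproj h₁).append hr)
        have h3 : w - δ + wr ≤ (w - δ + wr).toNat := Int.self_le_toNat _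
        push_cast at this
        nlinarith [Int.natCast_nonneg (w - δ + wr).toNat]

end Residues

section Marked

/-- Three copies of an automaton, visited in this order; the second copy cannot test for zero.
    Its runs follow the edges `E`, moving from the first copy to the second in state `s` at a
    counter value at least `B`, and from the second to the third in state `t`. The counter is
    lowered by `B` in the second copy. -/
inductive MarkedEdges {K : Type} (E : OCEdges K) (s t : K) (B : ℕ) : OCEdges (K ⊕ K ⊕ K)
  | before {r b a w r'} : E r b a w r' → MarkedEdges E s t B (.inl r) b a w (.inl r')
  | down : MarkedEdges E s t B (.inl s) false (-B) 0 (.inr (.inl s))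
  | middle {r a w r'} : E r false a w r' →
      MarkedEdges E s t B (.inr (.inl r)) false a w (.inr (.inl r'))
  | up : MarkedEdges E s t B (.inr (.inl t)) false B 0 (.inr (.inr t))
  | after {r b a w r'} : E r b a w r' → MarkedEdges E s t B (.inr (.inr r)) b a w (.inr (.inr r'))

variable {K : Type} {E : OCEdges K} {s t : K} {B : ℕ}

theorem OCRun.of_marked_after {n w p x q y}
    (h : OCRun (MarkedEdges E s t B) n w (.inr (.inr p)) x (.inr (.inr q)) y) :
    OCRun E n w p x q y := by
  generalize hp : (Sum.inr (Sum.inr p) : K ⊕ K ⊕ K) = p' at h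
  generalize hq : (Sum.inr (Sum.inr q) : K ⊕ K ⊕ K) = q' at h
  induction h generalizing p with
  | nil =>
    subst hp
    obtain rfl : q = p := by simpa using hq
    exact .nil _ _
  | cons he hy hb _ ih =>
    subst hp
    cases he with
    | after he => exact .cons he hy hb (ih rfl hq)

theorem OCRun.of_marked_middle {n w p x q y}
    (h : OCRun (MarkedEdges E s t B) n w (.inr (.inl p)) x (.inr (.inr q)) y) :
    ∃ z n₁ n₂ w₁ w₂, OCRun (testFree E) n₁ w₁ p x t z ∧ OCRun E n₂ w₂ t (z + B) q y ∧
      n = n₁ + 1 + n₂ ∧ w = w₁ + w₂ := by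
  generalize hp : (Sum.inr (Sum.inl p) : K ⊕ K ⊕ K) = p' at h
  generalize hq : (Sum.inr (Sum.inr q) : K ⊕ K ⊕ K) = q' at h
  induction h generalizing p with
  | nil =>
    subst hp
    simp at hq
  | cons he hy hb h ih =>
    subst hp
    cases he with
    | middle he =>
      obtain ⟨z, n₁, n₂, w₁, w₂, h₁, h₂, rfl, rfl⟩ := ih rfl hq
      exact ⟨z, _, _, _, _, .cons ⟨rfl, he⟩ hy (by simp) h₁, h₂, by omega, by ring⟩
    | up =>
      subst hq
      exact ⟨_, _, _, _, _, .nil _ _, h.of_marked_after.cast rfl rfl (by omega) rfl,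
        by omega, by ring⟩

theorem OCRun.of_marked {n w p x q y}
    (h : OCRun (MarkedEdges E s t B) n w (.inl p) x (.inr (.inr q)) y) :
    ∃ z z' n₁ n₂ n₃ w₁ w₂ w₃, OCRun E n₁ w₁ p x s (z + B) ∧ OCRun (testFree E) n₂ w₂ s z t z' ∧
      OCRun E n₃ w₃ t (z' + B) q y ∧ n = n₁ + n₂ + n₃ + 2 ∧ w = w₁ + w₂ + w₃ := by
  generalize hp : (Sum.inl p : K ⊕ K ⊕ K) = p' at h
  generalize hq : (Sum.inr (Sum.inr q) : K ⊕ K ⊕ K) = q' at h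
  induction h generalizing p with
  | nil =>
    subst hp
    simp at hq
  | cons he hy hb h ih =>
    subst hp
    cases he with
    | before he =>
      obtain ⟨z, z', n₁, n₂, n₃, w₁, w₂, w₃, h₁, h₂, h₃, rfl, rfl⟩ := ih rfl hq
      exact ⟨z, z', _, _, _, _, _, _, .cons he hy hb h₁, h₂, h₃, by omega, by ring⟩
    | down =>
      subst hq
      obtain ⟨z', n₂, n₃, w₂, w₃, h₂, h₃, rfl, rfl⟩ := h.of_marked_middle
      exact ⟨_, z', _, n₂, n₃, _, w₂, w₃, (OCRun.nil _ _).cast rfl rfl rfl (by omega), h₂, h₃,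
        by omega, by ring⟩

theorem OCRun.to_marked {n₁ n₂ n₃ w₁ w₂ w₃ p x q y z z'} (h₁ : OCRun E n₁ w₁ p x s (z + B))
    (h₂ : OCRun (testFree E) n₂ w₂ s z t z') (h₃ : OCRun E n₃ w₃ t (z' + B) q y) :
    ∃ n w, OCRun (MarkedEdges E s t B) n w (.inl p) x (.inr (.inr q)) y := by
  have h₁ := h₁.map (E' := MarkedEdges E s t B) Sum.inl fun _ _ _ _ _ => .before
  have h₂ := h₂.map (E' := MarkedEdges E s t B) (Sum.inr ∘ Sum.inl) fun _ _ _ _ _ he => by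
    obtain ⟨rfl, he⟩ := he
    exact .middle he
  have h₃ := h₃.map (E' := MarkedEdges E s t B) (Sum.inr ∘ Sum.inr) fun _ _ _ _ _ => .after
  exact ⟨_, _, h₁.append (.cons .down (by push_cast; ring) (by simp)
    (h₂.append (.cons .up (by push_cast; ring) (by simp) h₃)))⟩

/-- If some cycle can be pumped by short test-free segments of positive total weight, then some
    short cycle has positive weight. -/
theorem OCRun.exists_short_pos_of_pump [Fintype K] {T : ℕ} (hT : 2 ≤ T)
    (hK : 3 * Fintype.card K ≤ T) (hE : EdgesBdd E T) (hB : B ≤ T) {D l : ℕ} {p : K}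
    {n₁ n₂ n₃ n₄ n₅ w₁ w₂ w₃ w₄ w₅ z z'} (h₁ : OCRun E n₁ w₁ p 0 s (z + B))
    (h₂ : OCRun (testFree E) n₂ w₂ s B s (B + D)) (h₃ : OCRun (testFree E) n₃ w₃ s z t z')
    (h₄ : OCRun (testFree E) n₄ w₄ t (B + D) t B) (h₅ : OCRun E n₅ w₅ t (z' + B) p 0)
    (hl : n₂ + n₄ ≤ l) (hw : 0 < w₂ + w₄) :
    ∃ n w, n ≤ T ^ 7 + (T ^ 8 + 1) * l ∧ 0 < w ∧ OCRun E n w p 0 p 0 := by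
  have hE' : EdgesBdd (MarkedEdges E s t B) T := by
    intro s b a w t he
    cases he with
    | before he => exact hE _ _ _ _ _ he
    | down => simpa using hB
    | middle he => exact hE _ _ _ _ _ he
    | up => simpa using hB
    | after he => exact hE _ _ _ _ _ he
  obtain ⟨n, w, h⟩ := h₁.to_marked h₃ h₅
  obtain ⟨n, w, hn, h⟩ := h.exists_short hT (by simp; omega) hE' (Nat.zero_le _) (Nat.zero_le _)
  have hw' := abs_le.1 (h.abs_weight_le hE')
  obtain ⟨z, z', n₁, n₃, n₅, w₁, w₃, w₅, h₁, h₃, h₅, rfl, rfl⟩ := h.of_marked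
  set k := T ^ 8 + 1 with hk
  have g₂ := ((h₂.iterate_up k).lift z).of_testFree
  have g₃ := (h₃.lift (B + k * D)).of_testFree
  have g₄ := ((h₄.iterate_down k).lift z').of_testFree
  refine ⟨_, _, ?_, ?_, (((h₁.append (g₂.cast rfl rfl (by omega) rfl)).append
    (g₃.cast rfl rfl (by omega) rfl)).append (g₄.cast rfl rfl (by omega) (by omega))).append h₅⟩
  · have := Nat.mul_le_mul_left k hl
    rw [mul_add] at this
    omega
  · have h1 : (n₁ + n₃ + n₅ + 2) * T ≤ T ^ 8 := by
      calc _ ≤ T ^ 7 * T := Nat.mul_le_mul_right _ hn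
        _ = T ^ 8 := by ring
    have h2 : (((n₁ + n₃ + n₅ + 2) * T : ℕ) : ℤ) < k := by
      rw [hk]
      exact_mod_cast Nat.lt_succ_of_le h1
    push_cast at h2 hw'
    nlinarith

/-- If some cycle has positive weight, then so has some short cycle. -/
theorem OCRun.exists_short_pos [Fintype K] {T : ℕ} (hT : 2 ≤ T)
    (hK : Fintype.card K ≤ T) (hE : EdgesBdd E T) {p : K} {n w} (h : OCRun E n w p 0 p 0)
    (hw : 0 < w) : ∃ n w, n ≤ T ^ 83 ∧ 0 < w ∧ OCRun E n w p 0 p 0 := by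
  induction n using Nat.strong_induction_on generalizing w with
  | _ n ih =>
    rcases le_total n (T ^ 7) with hn | hn
    · exact ⟨n, w, hn.trans (Nat.pow_le_pow_right (by omega) (by omega)), hw, h⟩
    have h9 : T ^ 7 * T + 1 ≤ T ^ 9 := by
      have h1 : 1 ≤ T ^ 8 := Nat.one_le_pow _ _ (by omega)
      calc T ^ 7 * T + 1 = T ^ 8 + 1 := by ring
        _ ≤ T ^ 8 * T := by nlinarith
        _ = T ^ 9 := by ring
    have hT9 : T ≤ T ^ 9 := Nat.le_self_pow (by omega) _
    have hT9' : 3 * T ≤ T ^ 9 := by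
      have : 4 ≤ T ^ 8 := (Nat.pow_le_pow_left hT 2).trans
        (Nat.pow_le_pow_right (by omega) (by omega))
      calc 3 * T ≤ T ^ 8 * T := by nlinarith
        _ = T ^ 9 := by ring
    have hE9 : EdgesBdd E (T ^ 9) := hE.mono hT9
    have hfin : 2 * (T ^ 9) ^ 7 + (2 * (T ^ 9) ^ 8 + 1) * T ^ 7 ≤ T ^ 83 := by
      have h1 : 1 ≤ T ^ 72 := Nat.one_le_pow _ _ (by omega)
      have h2 : T ^ 63 ≤ T ^ 79 := Nat.pow_le_pow_right (by omega) (by omega)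
      have h4 : 8 ≤ T ^ 3 := Nat.pow_le_pow_left hT 3
      calc 2 * (T ^ 9) ^ 7 + (2 * (T ^ 9) ^ 8 + 1) * T ^ 7
          = 2 * T ^ 63 + (2 * T ^ 72 + 1) * T ^ 7 := by ring
        _ ≤ 2 * T ^ 79 + (2 * T ^ 72 + T ^ 72) * T ^ 7 := by gcongr
        _ = 5 * T ^ 79 := by ring
        _ ≤ T ^ 3 * T ^ 79 := by gcongr; omega
        _ ≤ T ^ 83 := by
          rw [← pow_add]
          exact Nat.pow_le_pow_right (by omega) (by omega)
    have hpump : ∀ {s t : K} {B D z z' n₁ n₂ n₃ n₄ n₅ : ℕ} {w₁ w₂ w₃ w₄ w₅ : ℤ}, B ≤ T ^ 9 →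
        OCRun E n₁ w₁ p 0 s (z + B) → OCRun (testFree E) n₂ w₂ s B s (B + D) →
        OCRun (testFree E) n₃ w₃ s z t z' → OCRun (testFree E) n₄ w₄ t (B + D) t B →
        OCRun E n₅ w₅ t (z' + B) p 0 → n₂ + n₄ ≤ T ^ 7 → 0 < w₂ + w₄ →
        ∃ n w, n ≤ T ^ 83 ∧ 0 < w ∧ OCRun E n w p 0 p 0 := by
      intro s t B D z z' n₁ n₂ n₃ n₄ n₅ w₁ w₂ w₃ w₄ w₅ hB h₁ h₂ h₃ h₄ h₅ hl hw
      obtain ⟨n, w, hn, hw, h⟩ := OCRun.exists_short_pos_of_pump (by omega) (by omega) hE9 hB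
        h₁ h₂ h₃ h₄ h₅ hl hw
      refine ⟨n, w, hn.trans (le_trans ?_ hfin), hw, h⟩
      gcongr <;> omega
    rcases h.exists_cut hT hK hE (Nat.zero_le _) (Nat.zero_le _) hn with
      ⟨s, z, n₁, n₂, n₃, w₁, w₂, w₃, hu, hv, hz, hpos, hl, rfl, rfl⟩ |
      ⟨s, t, z, z', D, n₁, n₂, n₃, n₄, n₅, w₁, w₂, w₃, w₄, w₅, hu, hv, hm, hv', hz, hpos, hl,
        rfl, rfl⟩
    · by_cases hw₂ : w₂ ≤ 0
      · exact ih (n₁ + n₃) (by omega) (hu.append hz) (by omega)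
      rcases le_total z (T ^ 9) with hz9 | hz9
      · obtain ⟨m₁, v₁, hm₁, g₁⟩ := hu.exists_short (T := T ^ 9) (by omega) (by omega) hE9
          (Nat.zero_le _) hz9
        obtain ⟨m₃, v₃, hm₃, g₃⟩ := hz.exists_short (T := T ^ 9) (by omega) (by omega) hE9
          hz9 (Nat.zero_le _)
        refine ⟨_, _, le_trans ?_ hfin, ?_,
          (g₁.append (hv.iterate (2 * (T ^ 9) ^ 8 + 1))).append g₃⟩
        · have := Nat.mul_le_mul_left (2 * (T ^ 9) ^ 8 + 1) hl
          omega
        · have a₁ := abs_le.1 (g₁.abs_weight_le hE9)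
          have a₃ := abs_le.1 (g₃.abs_weight_le hE9)
          have b : ∀ m : ℕ, m ≤ (T ^ 9) ^ 7 → (m : ℤ) * (T ^ 9 : ℕ) ≤ ((T ^ 9) ^ 8 : ℕ) := by
            intro m hm
            calc (m : ℤ) * (T ^ 9 : ℕ) ≤ ((T ^ 9) ^ 7 : ℕ) * (T ^ 9 : ℕ) := by
                  exact_mod_cast Nat.mul_le_mul_right _ hm
              _ = ((T ^ 9) ^ 8 : ℕ) := by push_cast; ring
          have b₁ := b m₁ hm₁
          have b₃ := b m₃ hm₃
          have c : ((2 * (T ^ 9) ^ 8 + 1 : ℕ) : ℤ) * 1 ≤ ((2 * (T ^ 9) ^ 8 + 1 : ℕ) : ℤ) * w₂ :=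
            mul_le_mul_of_nonneg_left (by omega) (by positivity)
          push_cast at *
          linarith
      · have hlT : n₂ * T ≤ T ^ 7 * T := Nat.mul_le_mul_right _ hl
        obtain ⟨z', hz', hv'⟩ := hv.translate hE (x' := T ^ 9) (by omega) (by omega)
        obtain rfl : z' = T ^ 9 := by omega
        exact hpump (s := s) (t := s) (B := T ^ 9) (D := 0) (z := z - T ^ 9) (z' := z - T ^ 9)
          (n₄ := 0) (w₄ := 0) le_rfl
          (hu.cast rfl rfl rfl (by omega)) hv' (.nil _ _) (.nil _ _)
          (hz.cast rfl rfl (by omega) rfl) (by omega) (by omega)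
    · by_cases hw₂ : w₂ + w₄ ≤ 0
      · exact ih (n₁ + n₃ + n₅) (by omega) ((hu.append hm.of_testFree).append hz) (by omega)
      · exact hpump (B := 0) (Nat.zero_le _) hu hv hm hv' hz hl (by omega)

end Marked

section Negation

/-- The edges with negated weights. -/
def negEdges {K : Type} (E : OCEdges K) : OCEdges K :=
  fun s b a w t => E s b a (-w) t

variable {K : Type} {E : OCEdges K}

theorem OCRun.neg {n : ℕ} {w : ℤ} {s t : K} {x y : ℕ} (h : OCRun E n w s x t y) :
    OCRun (negEdges E) n (-w) s x t y := by
  induction h with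
  | nil s x => exact .nil _ _
  | @cons _ _ _ _ _ w _ _ _ _ _ he hy hb _ ih =>
    exact (OCRun.cons (E := negEdges E) (w := -w) (by simpa [negEdges] using he) hy hb ih).cast
      rfl (by ring) rfl rfl

theorem OCRun.of_neg {n : ℕ} {w : ℤ} {s t : K} {x y : ℕ} (h : OCRun (negEdges E) n w s x t y) :
    OCRun E n (-w) s x t y := by
  have hE : negEdges (negEdges E) = E := by
    funext s b a w t
    simp [negEdges]
  simpa [hE] using h.neg

theorem EdgesBdd.neg {T : ℕ} (hE : EdgesBdd E T) : EdgesBdd (negEdges E) T :=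
  fun s b a w t he => by simpa using hE s b a (-w) t he

end Negation

section OneCycle

variable {K : Type} {E : OCEdges K} {T : ℕ} {p q : K}

/-- The weight `w` is achieved by a short run together with iterations of a short cycle. -/
def OneCycleWeight (E : OCEdges K) (T : ℕ) (p q : K) (w : ℤ) : Prop :=
  ∃ (n n' k : ℕ) (v w' : ℤ), n ≤ T ^ 1183 ∧ n' ≤ T ^ 1183 ∧ OCRun E n v p 0 p 0 ∧
    OCRun E n' w' p 0 q 0 ∧ w = k * v + w'

theorem OneCycleWeight.of_neg {w : ℤ} (h : OneCycleWeight (negEdges E) T p q (-w)) :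
    OneCycleWeight E T p q w := by
  obtain ⟨n, n', k, v, w', hn, hn', h, h', heq⟩ := h
  exact ⟨n, n', k, -v, -w', hn, hn', h.of_neg, h'.of_neg, by linarith⟩

variable [Fintype K]

/-- A short positive cycle, and its weight as a natural number. -/
theorem OCRun.exists_short_pos_nat (hT : 2 ≤ T) (hK : Fintype.card K ≤ T) (hE : EdgesBdd E T)
    {n : ℕ} {w : ℤ} (h : OCRun E n w p 0 p 0) (hw : 0 < w) :
    ∃ n v : ℕ, n ≤ T ^ 83 ∧ 0 < v ∧ v ≤ T ^ 84 ∧ OCRun E n v p 0 p 0 := by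
  obtain ⟨n, w, hn, hw, h⟩ := h.exists_short_pos hT hK hE hw
  lift w to ℕ using hw.le
  refine ⟨n, w, hn, by exact_mod_cast hw, ?_, h⟩
  have h1 := (abs_le.1 (h.abs_weight_le hE)).2
  calc w ≤ n * T := by exact_mod_cast h1
    _ ≤ T ^ 83 * T := Nat.mul_le_mul_right _ hn
    _ = T ^ 84 := by ring

theorem OCRun.exists_short_modEq_pow (hT : 2 ≤ T) (hK : Fintype.card K ≤ T) (hE : EdgesBdd E T)
    {m : ℕ} (hm : 0 < m) (hmT : m ≤ T ^ 168) {n : ℕ} {w : ℤ} (h : OCRun E n w p 0 q 0) :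
    ∃ n' w', n' ≤ T ^ 1183 ∧ (m : ℤ) ∣ w - w' ∧ OCRun E n' w' p 0 q 0 ∧
      ∀ nr wr, OCRun E nr wr q 0 p 0 → (∀ n w, OCRun E n w p 0 p 0 → 0 ≤ w) → w' ≤ w := by
  have hT' : T ≤ T ^ 169 := Nat.le_self_pow (by omega) _
  have := h.exists_short_modEq (T := T ^ 169) (by omega) hm
    ((Nat.mul_le_mul hK hmT).trans_eq (by ring)) (hE.mono hT')
  rwa [← pow_mul] at this

theorem oneCycleWeight_of_nonneg (hT : 2 ≤ T) (hK : Fintype.card K ≤ T) (hE : EdgesBdd E T)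
    {n nr : ℕ} {w wr : ℤ} (h : OCRun E n w p 0 q 0) (hr : OCRun E nr wr q 0 p 0)
    (hnn : ∀ n w, OCRun E n w p 0 p 0 → 0 ≤ w) : OneCycleWeight E T p q w := by
  by_cases hpos : ∃ n w, OCRun E n w p 0 p 0 ∧ 0 < w
  · obtain ⟨n₁, w₁, h₁, hw₁⟩ := hpos
    obtain ⟨n₁, v, hn₁, hv, hvT, h₁⟩ := h₁.exists_short_pos_nat hT hK hE hw₁
    obtain ⟨n', w', hn', ⟨k, hk⟩, h', hle⟩ := h.exists_short_modEq_pow hT hK hE hv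
      (hvT.trans (Nat.pow_le_pow_right (by omega) (by omega)))
    have hle := hle nr wr hr hnn
    have hk0 : 0 ≤ k := by
      by_contra hneg
      have : (v : ℤ) * k < 0 := mul_neg_of_pos_of_neg (by exact_mod_cast hv) (by omega)
      omega
    lift k to ℕ using hk0
    exact ⟨n₁, n', k, v, w', hn₁.trans (Nat.pow_le_pow_right (by omega) (by omega)), hn', h₁, h',
      by linarith⟩
  · push Not at hpos
    obtain ⟨n', w', hn', -, h', -⟩ := h.exists_short_modEq_pow hT hK hE one_pos
      (Nat.one_le_pow _ _ (by omega))
    refine ⟨0, n', 0, 0, w', Nat.zero_le _, hn', .nil _ _, h', ?_⟩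
    have h1 := hnn _ _ (h.append hr)
    have h2 := hpos _ _ (h.append hr)
    have h3 := hnn _ _ (h'.append hr)
    have h4 := hpos _ _ (h'.append hr)
    push_cast
    linarith

theorem OCRun.oneCycleWeight (hT : 2 ≤ T) (hK : Fintype.card K ≤ T) (hE : EdgesBdd E T)
    {n nr : ℕ} {w wr : ℤ} (h : OCRun E n w p 0 q 0) (hr : OCRun E nr wr q 0 p 0) :
    OneCycleWeight E T p q w := by
  by_cases hneg : ∃ n w, OCRun E n w p 0 p 0 ∧ w < 0
  swap
  · push Not at hneg
    exact oneCycleWeight_of_nonneg hT hK hE h hr hneg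
  by_cases hpos : ∃ n w, OCRun E n w p 0 p 0 ∧ 0 < w
  swap
  · push Not at hpos
    refine .of_neg (oneCycleWeight_of_nonneg hT hK hE.neg h.neg hr.neg fun n w h => ?_)
    have := hpos _ _ h.of_neg
    omega
  obtain ⟨n₁, w₁, h₁, hw₁⟩ := hpos
  obtain ⟨n₁, v₁, hn₁, hv₁, hvT₁, h₁⟩ := h₁.exists_short_pos_nat hT hK hE hw₁
  obtain ⟨n₂, w₂, h₂, hw₂⟩ := hneg
  obtain ⟨n₂, v₂, hn₂, hv₂, hvT₂, h₂⟩ :=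
    h₂.neg.exists_short_pos_nat hT hK hE.neg (by omega)
  obtain ⟨n', w', hn', ⟨k, hk⟩, h', -⟩ := h.exists_short_modEq_pow hT hK hE
    (Nat.mul_pos hv₁ hv₂) ((Nat.mul_le_mul hvT₁ hvT₂).trans_eq (by ring))
  have hpow : T ^ 83 ≤ T ^ 1183 := Nat.pow_le_pow_right (by omega) (by omega)
  push_cast at hk
  obtain ⟨k, rfl | rfl⟩ := k.eq_nat_or_neg
  · exact ⟨n₁, n', k * v₂, v₁, w', hn₁.trans hpow, hn', h₁, h', by push_cast; linarith⟩
  · exact ⟨n₂, n', k * v₁, -v₂, w', hn₂.trans hpow, hn', h₂.of_neg, h', by push_cast; linarith⟩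

end OneCycle

/-- The weighted one-counter automaton of a 2-TVASS: the second counter becomes the weight. -/
def TVASS.ocEdges (V : TVASS 2 Q) : OCEdges Q := fun s b a w t =>
  ∃ l : Act 2, (s, l, t) ∈ V.trans ∧ b = l.isNone ∧ a = l.elim 0 (· 0) ∧ w = l.elim 0 (· 1)

theorem TVASS.edgesBdd_ocEdges (V : TVASS 2 Q) {T : ℕ} (hT : V.actNorm ≤ T) :
    EdgesBdd V.ocEdges T := by
  rintro s b a w t ⟨l, hl, -, rfl, rfl⟩
  cases l with
  | none => simp
  | some u =>
    have h1 : vnormZ u ≤ V.actNorm :=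
      Finset.le_sup (f := fun a : Act 2 => a.elim 0 vnormZ) (V.mem_acts _ hl)
    have h2 : ∀ i, (u i).natAbs ≤ vnormZ u := fun i =>
      Finset.le_sup (f := fun i => (u i).natAbs) (Finset.mem_univ i)
    have h3 := h2 0
    have h4 := h2 1
    simp only [Option.elim_some, abs_le]
    omega

theorem Run.ocRun {V : TVASS 2 Q} {c c' : Config 2 Q} {π : List (Trans 2 Q)}
    (h : Run V c π c') :
    OCRun V.ocEdges π.length ((c'.2 1 : ℤ) - c.2 1) c.1 (c.2 0) c'.1 (c'.2 0) := by
  induction h with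
  | nil c => simpa using OCRun.nil c.1 (c.2 0)
  | @cons t c c' c'' π ht hs _ ih =>
    obtain ⟨s, l, t⟩ := t
    obtain ⟨h1, h2, h3⟩ := hs
    dsimp only at h1 h2 h3
    subst h1 h2
    refine (OCRun.cons (w := (c'.2 1 : ℤ) - c.2 1) (a := (c'.2 0 : ℤ) - c.2 0) (b := l.isNone)
      ⟨l, ht, rfl, ?_⟩ (by ring) ?_ ih).cast rfl (by ring) rfl rfl
    · cases l with
      | none => intro; simp [h3.1, h3.2]
      | some u => simp
    · cases l with
      | none => simp [h3.2]
      | some u => simp [h3]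

theorem Run.append {V : TVASS 2 Q} {c c' c'' : Config 2 Q} {π π' : List (Trans 2 Q)}
    (h : Run V c π c') (h' : Run V c' π' c'') : Run V c (π ++ π') c'' := by
  induction h with
  | nil c => exact h'
  | cons ht hs _ ih => exact .cons ht hs (ih h')

/-- A run of the one-counter automaton lifts to runs from all large values of the second
    counter. -/
theorem OCRun.exists_path {V : TVASS 2 Q} {T : ℕ} (hE : EdgesBdd V.ocEdges T) {n : ℕ} {w : ℤ}
    {s t : Q} {a b : ℕ} (h : OCRun V.ocEdges n w s a t b) :
    ∃ π, π.length = n ∧ IsPathFrom V s π t ∧ ∀ x y : ℕ, n * T ≤ x → (y : ℤ) = x + w →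
      Run V (s, ![a, x]) π (t, ![b, y]) := by
  induction h with
  | nil s a =>
    refine ⟨[], rfl, .nil _, fun x y _ hxy => ?_⟩
    obtain rfl : y = x := by omega
    exact .nil _
  | @cons s t _ b a w _ n z z' _ he hy hb _ ih =>
    have hw := abs_le.1 (hE _ _ _ _ _ he).2
    obtain ⟨l, hl, rfl, rfl, rfl⟩ := he
    obtain ⟨π, rfl, hpath, hrun⟩ := ih
    refine ⟨(s, l, t) :: π, rfl, .cons (t := (s, l, t)) hl hpath, fun x y hx hxy => ?_⟩
    rw [add_mul, one_mul] at hx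
    have hx' : ((x + l.elim 0 (· 1) : ℤ).toNat : ℤ) = x + l.elim 0 (· 1) := by omega
    refine .cons hl ⟨rfl, rfl, ?_⟩ (hrun (x + l.elim 0 (· 1) : ℤ).toNat y (by omega) (by omega))
    cases l with
    | none =>
      obtain ⟨rfl, rfl⟩ := hb rfl
      simp
    | some u =>
      intro i
      fin_cases i
      · simpa using hy
      · simpa using hx'

theorem Run.pw {V : TVASS 2 Q} {s : Q} {β : List (Trans 2 Q)} {B : ℕ} {v : ℤ}
    (hβ : ∀ x y : ℕ, B ≤ x → (y : ℤ) = x + v → Run V (s, ![0, x]) β (s, ![0, y])) (k : ℕ)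
    {x y : ℕ} (hx : B ≤ x) (hy : B ≤ y) (hxy : (y : ℤ) = x + k * v) :
    Run V (s, ![0, x]) (TVASSpaper.pw β k) (s, ![0, y]) := by
  induction k generalizing x with
  | zero =>
    obtain rfl : y = x := by simpa using hxy
    exact .nil _
  | succ k ih =>
    have hmid : (B : ℤ) ≤ x + v := by
      rcases le_total 0 v with hv | hv
      · omega
      · have : (k : ℤ) * v ≤ 0 := mul_nonpos_of_nonneg_of_nonpos (by positivity) hv
        push_cast at hxy
        linarith
    have hcast : ((x + v).toNat : ℤ) = x + v := by omega
    rw [TVASSpaper.pw, List.replicate_succ, List.flatten_cons]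
    refine (hβ x (x + v).toNat hx hcast).append (ih (by omega) ?_)
    rw [hcast, hxy]
    push_cast
    ring

theorem OneCycleWeight.exists_lps [Fintype Q] {V : TVASS 2 Q} {T : ℕ}
    (hE : EdgesBdd V.ocEdges T) {p q : Q} {x y : ℕ}
    (h : OneCycleWeight V.ocEdges T p q ((y : ℤ) - x)) (hx : 4 * T ^ 1184 ≤ x)
    (hy : 4 * T ^ 1184 ≤ y) :
    ∃ L : LPS 2 Q, IsLPS V p L q ∧ L.len ≤ 2 * T ^ 1183 ∧ L.stars = 1 ∧
      ReachLPS V L (p, ![0, x]) (q, ![0, y]) := by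
  obtain ⟨n, n', k, v, w', hn, hn', hβ, hα, heq⟩ := h
  have hw' := abs_le.1 (hα.abs_weight_le hE)
  have hnT : n * T ≤ T ^ 1184 := (Nat.mul_le_mul_right _ hn).trans_eq (pow_succ _ _).symm
  have hnT' : n' * T ≤ T ^ 1184 := (Nat.mul_le_mul_right _ hn').trans_eq (pow_succ _ _).symm
  obtain ⟨β, rfl, hβp, hβr⟩ := hβ.exists_path hE
  obtain ⟨α, rfl, hαp, hαr⟩ := hα.exists_path hE
  refine ⟨⟨[], [(β, α)]⟩, ⟨p, .nil p, .cons hβp hαp (.nil q)⟩, ?_, rfl, [k], ?_⟩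
  · simp only [LPS.len, List.length_nil, List.map_cons, List.map_nil, List.sum_cons, List.sum_nil]
    omega
  · have hz : (((y : ℤ) - w').toNat : ℤ) = y - w' := by omega
    have h1 := Run.pw hβr k (x := x) (y := ((y : ℤ) - w').toNat) (by omega) (by omega)
      (by rw [hz]; linarith)
    have h2 := hαr ((y : ℤ) - w').toNat y (by omega) (by omega)
    simpa [LPS.word, wordRest] using h1.append h2

/-- Lemma: large-large reachability with one star. -/
theorem large_large_one_star :
    ∃ h c : ℕ, 1 ≤ h ∧ 1 ≤ c ∧
      ∀ (Q : Type) [Fintype Q] [Nonempty Q] (V : TVASS 2 Q)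
        (p q : Q) (x y : ℕ),
        Leads V q p →
        (Fintype.card Q + V.actNorm) ^ h ≤ x →
        (Fintype.card Q + V.actNorm) ^ h ≤ y →
        Reach V (p, ![0, x]) (q, ![0, y]) →
        ∃ L : LPS 2 Q, IsLPS V p L q ∧
          L.len ≤ (Fintype.card Q + V.actNorm) ^ c ∧
          L.stars = 1 ∧
          ReachLPS V L (p, ![0, x]) (q, ![0, y]) := by
  refine ⟨1186, 1184, by omega, by omega, ?_⟩
  intro Q _ _ V p q x y ⟨x', y', πr, hr⟩ hx hy ⟨π, h⟩
  have hcard : 0 < Fintype.card Q := Fintype.card_pos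
  have hrun : OCRun V.ocEdges π.length ((y : ℤ) - x) p 0 q 0 := by simpa using h.ocRun
  have hrun_r : OCRun V.ocEdges πr.length ((y' : ℤ) - x') q 0 p 0 := by simpa using hr.ocRun
  by_cases hT : 2 ≤ Fintype.card Q + V.actNorm
  · have hE := V.edgesBdd_ocEdges (T := Fintype.card Q + V.actNorm) (by omega)
    generalize hTT : Fintype.card Q + V.actNorm = T at *
    have hbig : 4 * T ^ 1184 ≤ T ^ 1186 := by
      rw [pow_add T 1184 2, mul_comm]
      exact Nat.mul_le_mul_left _ (Nat.pow_le_pow_left hT 2)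
    have hlen : 2 * T ^ 1183 ≤ T ^ 1184 := by
      rw [pow_succ T 1183, mul_comm]
      exact Nat.mul_le_mul_left _ hT
    obtain ⟨L, h1, h2, h3, h4⟩ := (hrun.oneCycleWeight hT (by omega) hE hrun_r).exists_lps hE
      (hbig.trans hx) (hbig.trans hy)
    exact ⟨L, h1, h2.trans hlen, h3, h4⟩
  · have : Subsingleton Q := Fintype.card_le_one_iff_subsingleton.1 (by omega)
    obtain rfl := Subsingleton.elim p q
    have hw := hrun.abs_weight_le (V.edgesBdd_ocEdges (T := 0) (by omega))
    obtain rfl : x = y := by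
      rw [Nat.cast_zero, mul_zero, abs_nonpos_iff] at hw
      omega
    exact ⟨⟨[], [([], [])]⟩, ⟨p, .nil p, .cons (.nil p) (.nil p) (.nil p)⟩, Nat.zero_le _, rfl,
      [], .nil _⟩

end TVASSpaper
end

section
/- Let V be an OCA with state set Q, let m ≥ 1, and let p, q be states. If p(0) →^π q(0) for a path π with |π| ≥ m²|Q|³, then there exist paths α, γ, η and cycles β₁, …, β_m, θ₁, …, θ_m such that π = α β₁ ⋯ β_m γ θ_m ⋯ θ₁ η, the word β_ℓ θ_ℓ is nonempty for every ℓ ∈ {1,…,m}, and for all n₁, …, n_m ∈ ℕ, p(0) →^{α β₁^{n₁} ⋯ β_m^{n_m} γ θ_m^{n_m} ⋯ θ₁^{n₁} η} q(0). -/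
namespace TVASSpaper

/-- Actions of a one-counter automaton: `some a` with `a ∈ {-1,0,+1}` is an
    addition, `none` is the zero-test `tst`. -/
abbrev OAct := Option ℤ

abbrev OTrans (Q : Type) := Q × OAct × Q

/-- A one-counter automaton: a finite set of transitions
    `Δ ⊆ Q × ({-1,0,+1} ∪ {tst}) × Q`. -/
structure OCA (Q : Type) where
  trans : Finset (OTrans Q)
  small : ∀ t ∈ trans, ∀ a : ℤ, t.2.1 = some a → a.natAbs ≤ 1

variable {Q : Type}

/-- The step induced by a single transition of an OCA. -/
def OStepBy (t : OTrans Q) (c c' : Q × ℕ) : Prop :=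
  t.1 = c.1 ∧ t.2.2 = c'.1 ∧
    match t.2.1 with
    | some a => (c'.2 : ℤ) = (c.2 : ℤ) + a
    | none => c.2 = 0 ∧ c'.2 = 0

/-- `ORun V c π c'` : there is a run from `c` to `c'` taking the steps of the
    word of transitions `π` in order. -/
inductive ORun (V : OCA Q) : Q × ℕ → List (OTrans Q) → Q × ℕ → Prop
  | nil (c : Q × ℕ) : ORun V c [] c
  | cons {t : OTrans Q} {c c' c'' : Q × ℕ} {π : List (OTrans Q)} :
      t ∈ V.trans → OStepBy t c c' → ORun V c' π c'' → ORun V c (t :: π) c''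

/-- Reachability `c →* c'` in an OCA. -/
def OReach (V : OCA Q) (c c' : Q × ℕ) : Prop := ∃ π, ORun V c π c'

/-- `OIsPathFrom V p π q` : `π` is a path of `V` from state `p` to state `q`. -/
inductive OIsPathFrom (V : OCA Q) : Q → List (OTrans Q) → Q → Prop
  | nil (p : Q) : OIsPathFrom V p [] p
  | cons {t : OTrans Q} {π : List (OTrans Q)} {q : Q} :
      t ∈ V.trans → OIsPathFrom V t.2.2 π q → OIsPathFrom V t.1 (t :: π) q

/-- A weighted one-counter automaton: an OCA with a weight function on
    transitions. -/
structure WOCA (Q : Type) extends OCA Q where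
  wt : OTrans Q → ℤ

/-- The weight of a path: the sum of the weights of its transitions. -/
def wlen (W : WOCA Q) (π : List (OTrans Q)) : ℤ := (π.map W.wt).sum

/-- The factor of `l` between the positions `i` and `j`. -/
def slice {α : Type*} (l : List α) (i j : ℕ) : List α := (l.drop i).take (j - i)

lemma slice_self {α : Type*} (l : List α) (i : ℕ) : slice l i i = [] := by
  simp [slice]

lemma slice_append_slice {α : Type*} (l : List α) {i j k : ℕ} (hij : i ≤ j) (hjk : j ≤ k) :
    slice l i j ++ slice l j k = slice l i k := by
  have h1 : k - i = (j - i) + (k - j) := by omega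
  have h2 : l.drop j = (l.drop i).drop (j - i) := by
    rw [List.drop_drop]; congr 1; omega
  rw [slice, slice, slice, h1, h2, ← List.take_add]

lemma slice_ne_nil {α : Type*} {l : List α} {i j : ℕ} (hij : i < j) (hj : j ≤ l.length) :
    slice l i j ≠ [] := by
  intro h
  have := congrArg List.length h
  simp [slice] at this
  omega

lemma slice_eq_cons {α : Type*} {l : List α} {i j : ℕ} {t : α} (ht : l[i]? = some t)
    (hij : i < j) : slice l i j = t :: slice l (i + 1) j := by
  obtain ⟨hi, rfl⟩ := List.getElem?_eq_some_iff.1 ht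
  have h : j - i = (j - (i + 1)) + 1 := by omega
  rw [slice, slice, List.drop_eq_getElem_cons hi, h, List.take_succ_cons]

lemma flatten_ofFn_slice {α : Type*} (l : List α) {m : ℕ} (i : Fin (m + 1) → ℕ)
    (hi : Monotone i) :
    (List.ofFn fun ℓ : Fin m => slice l (i ℓ.castSucc) (i ℓ.succ)).flatten =
      slice l (i 0) (i (Fin.last m)) := by
  induction m with
  | zero => simp [slice_self]
  | succ m ih =>
    have h := ih (fun ℓ => i ℓ.succ) fun a b hab => hi (Fin.succ_le_succ_iff.2 hab)
    simp only [← Fin.castSucc_succ] at h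
    rw [List.ofFn_succ, List.flatten_cons, h]
    exact slice_append_slice l (hi (Fin.zero_le _)) (hi (Fin.le_last _))

lemma flatten_reverse_ofFn_slice {α : Type*} (l : List α) {m : ℕ} (j : Fin (m + 1) → ℕ)
    (hj : Antitone j) :
    (List.ofFn fun ℓ : Fin m => slice l (j ℓ.succ) (j ℓ.castSucc)).reverse.flatten =
      slice l (j (Fin.last m)) (j 0) := by
  induction m with
  | zero => simp [slice_self]
  | succ m ih =>
    have h := ih (fun ℓ => j ℓ.succ) fun a b hab => hj (Fin.succ_le_succ_iff.2 hab)
    rw [List.ofFn_succ, List.reverse_cons, List.flatten_append]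
    simp only [← Fin.castSucc_succ] at h ⊢
    rw [h]
    simpa using slice_append_slice l (hj (Fin.le_last _)) (hj (Fin.zero_le _))

lemma ORun.isPathFrom {V : OCA Q} {c c' : Q × ℕ} {π : List (OTrans Q)} (h : ORun V c π c') :
    OIsPathFrom V c.1 π c'.1 := by
  induction h with
  | nil c => exact .nil _
  | cons ht hs _ ih =>
    rw [← hs.1]
    exact .cons ht (hs.2.1 ▸ ih)

lemma ORun.append {V : OCA Q} {c c' c'' : Q × ℕ} {π ρ : List (OTrans Q)}
    (h : ORun V c π c') (hρ : ORun V c' ρ c'') : ORun V c (π ++ ρ) c'' := by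
  induction h with
  | nil c => exact hρ
  | cons ht hs _ ih => exact .cons ht hs (ih hρ)

/-- `V` can take the `i`-th transition of `π` from `c` to `c'`. -/
def StepAt (V : OCA Q) (π : List (OTrans Q)) (i : ℕ) (c c' : Q × ℕ) : Prop :=
  ∃ t, π[i]? = some t ∧ t ∈ V.trans ∧ OStepBy t c c'

lemma StepAt.snd_bounds {V : OCA Q} {π : List (OTrans Q)} {i : ℕ} {c c' : Q × ℕ}
    (h : StepAt V π i c c') : c'.2 ≤ c.2 + 1 ∧ c.2 ≤ c'.2 + 1 := by
  obtain ⟨⟨a, o, b⟩, -, ht, -, -, hs⟩ := h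
  cases o with
  | none => simp only at hs; omega
  | some z =>
    have := V.small _ ht z rfl
    simp only at hs
    omega

/-- A step that does not happen at counter value zero throughout is an addition, hence
invariant under translations of the counter. -/
lemma StepAt.translate {V : OCA Q} {π : List (OTrans Q)} {i : ℕ} {c c' : Q × ℕ}
    (h : StepAt V π i c c') {x : ℕ} (hx : x ≤ c.2) (hx' : x ≤ c'.2) (hpos : 0 < c.2 + c'.2)
    (k : ℕ) : StepAt V π i (c.1, k + (c.2 - x)) (c'.1, k + (c'.2 - x)) := by
  obtain ⟨⟨a, o, b⟩, hi, ht, h1, h2, hs⟩ := h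
  refine ⟨_, hi, ht, h1, h2, ?_⟩
  cases o with
  | none => simp only at hs; omega
  | some z =>
    simp only at hs ⊢
    omega

lemma ORun.exists_trace {V : OCA Q} {c c' : Q × ℕ} {π : List (OTrans Q)} (h : ORun V c π c') :
    ∃ g : ℕ → Q × ℕ, g 0 = c ∧ g π.length = c' ∧
      ∀ i < π.length, StepAt V π i (g i) (g (i + 1)) := by
  induction h with
  | nil c => exact ⟨fun _ => c, rfl, rfl, by simp⟩
  | @cons t c c' c'' π ht hs _ ih =>
    obtain ⟨g, h0, hl, hg⟩ := ih
    refine ⟨fun i => Nat.casesOn i c g, rfl, hl, ?_⟩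
    rintro (_ | i) hi
    · exact ⟨t, rfl, ht, by rw [← h0] at hs; exact hs⟩
    · exact hg i (by simpa using hi)

lemma ORun.of_steps {V : OCA Q} {π : List (OTrans Q)} {g : ℕ → Q × ℕ} {i j : ℕ} (hij : i ≤ j)
    (h : ∀ t, i ≤ t → t < j → StepAt V π t (g t) (g (t + 1))) :
    ORun V (g i) (slice π i j) (g j) := by
  induction hij using Nat.decreasingInduction with
  | self => rw [slice_self]; exact .nil _
  | of_succ i hij ih =>
    obtain ⟨t, hi, ht, hs⟩ := h i le_rfl hij
    rw [slice_eq_cons hi hij]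
    exact .cons ht hs (ih fun t h1 h2 => h t (by omega) h2)

lemma pw_succ' {α : Type*} (l : List α) (n : ℕ) : pw l (n + 1) = pw l n ++ l := by
  simp [pw, List.replicate_succ']

lemma pw_succ {α : Type*} (l : List α) (n : ℕ) : pw l (n + 1) = l ++ pw l n := by
  simp [pw, List.replicate_succ]

/-- If `K` is closed under adding each `d ℓ`, `β ℓ` adds `d ℓ` from every value in `K`, and `θ ℓ`
takes it back, then the pairs `(β ℓ, θ ℓ)` can be pumped around `γ`. -/
lemma ORun.pump_nested {V : OCA Q} {K : Set ℕ} {r s : Q} {γ : List (OTrans Q)}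
    (hγ : ∀ k ∈ K, ORun V (r, k) γ (s, k)) {m : ℕ} {β θ : Fin m → List (OTrans Q)}
    {d : Fin m → ℕ} (hK : ∀ ℓ, ∀ k ∈ K, k + d ℓ ∈ K)
    (hβ : ∀ ℓ, ∀ k ∈ K, ORun V (r, k) (β ℓ) (r, k + d ℓ))
    (hθ : ∀ ℓ, ∀ k ∈ K, ORun V (s, k + d ℓ) (θ ℓ) (s, k)) (ns : Fin m → ℕ) :
    ∀ k ∈ K, ORun V (r, k)
      ((List.ofFn fun ℓ => pw (β ℓ) (ns ℓ)).flatten ++ γ ++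
        ((List.ofFn fun ℓ => pw (θ ℓ) (ns ℓ)).reverse).flatten) (s, k) := by
  induction m with
  | zero => simpa using hγ
  | succ m ih =>
    have inner := ih (fun ℓ => hK ℓ.succ) (fun ℓ => hβ ℓ.succ) (fun ℓ => hθ ℓ.succ)
      fun ℓ => ns ℓ.succ
    rw [List.ofFn_succ, List.ofFn_succ, List.reverse_cons, List.flatten_append,
      List.flatten_cons, List.flatten_singleton]
    generalize ns 0 = n
    induction n with
    | zero => simpa [pw] using inner
    | succ n ihn =>
      intro k hk
      rw [pw_succ, pw_succ']
      simpa using (hβ 0 k hk).append ((ihn _ (hK 0 k hk)).append (hθ 0 k hk))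

/-- Cutting a run at nested positions `i 0 < ⋯ < i m ≤ j m ≤ ⋯ ≤ j 0` so that the pieces can be
pumped. -/
lemma exists_pumpable_of_positions {V : OCA Q} {m : ℕ} {π : List (OTrans Q)} {g : ℕ → Q × ℕ}
    (hg : ∀ t < π.length, StepAt V π t (g t) (g (t + 1)))
    {i j : Fin (m + 1) → ℕ} (hi : StrictMono i) (hj : Antitone j)
    (hij : i (Fin.last m) ≤ j (Fin.last m)) (hjl : j 0 ≤ π.length)
    {K : Set ℕ} {r s : Q} {x : ℕ} (hx : x ∈ K) (hi0 : g (i 0) = (r, x)) (hj0 : g (j 0) = (s, x))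
    (d : Fin m → ℕ) (hK : ∀ ℓ, ∀ k ∈ K, k + d ℓ ∈ K)
    (hγ : ∀ k ∈ K, ORun V (r, k) (slice π (i (Fin.last m)) (j (Fin.last m))) (s, k))
    (hβ : ∀ ℓ : Fin m, ∀ k ∈ K,
      ORun V (r, k) (slice π (i ℓ.castSucc) (i ℓ.succ)) (r, k + d ℓ))
    (hθ : ∀ ℓ : Fin m, ∀ k ∈ K,
      ORun V (s, k + d ℓ) (slice π (j ℓ.succ) (j ℓ.castSucc)) (s, k)) :
    ∃ (α γ η : List (OTrans Q)) (β θ : Fin m → List (OTrans Q)),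
      π = α ++ (List.ofFn β).flatten ++ γ ++ ((List.ofFn θ).reverse).flatten ++ η ∧
      (∀ ℓ : Fin m, ∃ r, OIsPathFrom V r (β ℓ) r) ∧
      (∀ ℓ : Fin m, ∃ s, OIsPathFrom V s (θ ℓ) s) ∧
      (∀ ℓ : Fin m, β ℓ ++ θ ℓ ≠ []) ∧
      ∀ ns : Fin m → ℕ,
        ORun V (g 0)
          (α ++ (List.ofFn fun ℓ => pw (β ℓ) (ns ℓ)).flatten ++ γ ++
            ((List.ofFn fun ℓ => pw (θ ℓ) (ns ℓ)).reverse).flatten ++ η)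
          (g π.length) := by
  have hi0l : i 0 ≤ i (Fin.last m) := hi.monotone (Fin.zero_le _)
  have hjl0 : j (Fin.last m) ≤ j 0 := hj (Fin.zero_le _)
  refine ⟨slice π 0 (i 0), slice π (i (Fin.last m)) (j (Fin.last m)), slice π (j 0) π.length,
    fun ℓ => slice π (i ℓ.castSucc) (i ℓ.succ), fun ℓ => slice π (j ℓ.succ) (j ℓ.castSucc),
    ?_, fun ℓ => ⟨r, (hβ ℓ x hx).isPathFrom⟩, fun ℓ => ⟨s, (hθ ℓ x hx).isPathFrom⟩, ?_, ?_⟩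
  · rw [flatten_ofFn_slice π i hi.monotone, flatten_reverse_ofFn_slice π j hj,
      slice_append_slice, slice_append_slice, slice_append_slice, slice_append_slice]
    · simp [slice]
    all_goals omega
  · intro ℓ h
    refine slice_ne_nil (hi ℓ.castSucc_lt_succ) ?_ (List.append_eq_nil_iff.1 h).1
    exact (hi.monotone (Fin.le_last _)).trans (by omega)
  · intro ns
    have hα := ORun.of_steps (V := V) (π := π) (g := g) (Nat.zero_le (i 0))
      fun t _ ht => hg t (by omega)
    have hη := ORun.of_steps (V := V) (π := π) (g := g) hjl fun t _ ht => hg t ht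
    rw [hi0] at hα
    rw [hj0] at hη
    simpa using (hα.append (ORun.pump_nested hγ hK hβ hθ ns x hx)).append hη

/-- A sequence that starts below `x`, ends above `x`, and increases by at most one per step has a
last visit to `x`. -/
lemma exists_last_visit {v : ℕ → ℕ} {T x : ℕ} (hstep : ∀ t < T, v (t + 1) ≤ v t + 1)
    (h0 : v 0 ≤ x) (hT : x ≤ v T) :
    ∃ i ≤ T, v i = x ∧ ∀ t, i < t → t ≤ T → x < v t := by
  induction T with
  | zero => exact ⟨0, le_rfl, by omega, fun t _ _ => by omega⟩
  | succ T ih =>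
    rcases hT.eq_or_lt with hT | hT
    · exact ⟨T + 1, le_rfl, hT.symm, fun t _ _ => by omega⟩
    · have := hstep T (by omega)
      obtain ⟨i, hiT, hi, h⟩ := ih (fun t ht => hstep t (by omega)) (by omega)
      refine ⟨i, by omega, hi, fun t h1 h2 => ?_⟩
      rcases h2.eq_or_lt with rfl | h2
      · exact hT
      · exact h t h1 (by omega)

/-- A sequence that starts above `x`, ends below `x`, and decreases by at most one per step has a
first visit to `x`. -/
lemma exists_first_visit {v : ℕ → ℕ} {T L x : ℕ} (hTL : T ≤ L)
    (hstep : ∀ t < L, v t ≤ v (t + 1) + 1) (hT : x ≤ v T) (hL : v L ≤ x) :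
    ∃ j, T ≤ j ∧ j ≤ L ∧ v j = x ∧ ∀ t, T ≤ t → t < j → x < v t := by
  obtain ⟨i, hi, hvi, h⟩ := exists_last_visit (v := fun t => v (L - t)) (T := L - T) (x := x)
    (fun t ht => by
      have := hstep (L - (t + 1)) (by omega)
      rwa [show L - (t + 1) + 1 = L - t by omega] at this)
    (by simpa using hL) (by simpa [Nat.sub_sub_self hTL] using hT)
  refine ⟨L - i, by omega, by omega, hvi, fun t h1 h2 => ?_⟩
  simpa [Nat.sub_sub_self (show t ≤ L by omega)] using h (L - t) (by omega) (by omega)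

/-- Lemma: hill-cutting, `m` pairs of pumpable cycles in an OCA run. -/
theorem oca_hill_cutting (Q : Type) [Fintype Q] [Nonempty Q]
    (V : OCA Q) (m : ℕ) (hm : 1 ≤ m) (p q : Q) (π : List (OTrans Q))
    (hrun : ORun V (p, 0) π (q, 0))
    (hlen : m ^ 2 * Fintype.card Q ^ 3 ≤ π.length) :
    ∃ (α γ η : List (OTrans Q)) (β θ : Fin m → List (OTrans Q)),
      π = α ++ (List.ofFn β).flatten ++ γ ++ ((List.ofFn θ).reverse).flatten ++ η ∧
      (∀ ℓ : Fin m, ∃ r, OIsPathFrom V r (β ℓ) r) ∧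
      (∀ ℓ : Fin m, ∃ s, OIsPathFrom V s (θ ℓ) s) ∧
      (∀ ℓ : Fin m, β ℓ ++ θ ℓ ≠ []) ∧
      ∀ ns : Fin m → ℕ,
        ORun V (p, 0)
          (α ++ (List.ofFn fun ℓ => pw (β ℓ) (ns ℓ)).flatten ++ γ ++
            ((List.ofFn fun ℓ => pw (θ ℓ) (ns ℓ)).reverse).flatten ++ η)
          (q, 0) := by
  classical
  obtain ⟨g, h0, hl, hg⟩ := hrun.exists_trace
  rw [← h0, ← hl]
  set n := Fintype.card Q with hn
  have hnpos : 0 < n := Fintype.card_pos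
  by_cases hbig : ∃ T ≤ π.length, m * n ^ 2 ≤ (g T).2
  · obtain ⟨T, hTl, hT⟩ := hbig
    have hup : ∀ x, x ≤ m * n ^ 2 → ∃ i ≤ T, (g i).2 = x ∧ ∀ t, i < t → t ≤ T → x < (g t).2 :=
      fun x hx => exists_last_visit (v := fun t => (g t).2)
        (fun t ht => (hg t (by omega)).snd_bounds.1) (by simp [h0]) (hx.trans hT)
    have hdown : ∀ x, x ≤ m * n ^ 2 →
        ∃ j, T ≤ j ∧ j ≤ π.length ∧ (g j).2 = x ∧ ∀ t, T ≤ t → t < j → x < (g t).2 :=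
      fun x hx => exists_first_visit (v := fun t => (g t).2) hTl
        (fun t ht => (hg t ht).snd_bounds.2) (hx.trans hT) (by simp [hl])
    choose! i hiT hi hi' using hup
    choose! j hTj hjl hj hj' using hdown
    obtain ⟨⟨r, s⟩, -, hrs⟩ := Finset.exists_lt_card_fiber_of_mul_lt_card_of_maps_to
      (s := Finset.range (m * n ^ 2 + 1)) (t := (Finset.univ : Finset (Q × Q)))
      (f := fun x => ((g (i x)).1, (g (j x)).1)) (n := m) (fun _ _ => Finset.mem_univ _)
      (by
        rw [Finset.card_univ, Fintype.card_prod, Finset.card_range, ← hn]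
        exact Nat.lt_succ_of_le (by ring_nf; exact le_rfl))
    let x := Finset.orderEmbOfCardLe _ (Nat.succ_le_of_lt hrs)
    have hxmem := fun ℓ => Finset.orderEmbOfCardLe_mem _ (Nat.succ_le_of_lt hrs) ℓ
    have hx : ∀ ℓ, x ℓ ≤ m * n ^ 2 := fun ℓ => by
      have := (Finset.mem_filter.1 (hxmem ℓ)).1
      exact Nat.lt_succ_iff.1 (Finset.mem_range.1 this)
    have hxr : ∀ ℓ, g (i (x ℓ)) = (r, x ℓ) := fun ℓ =>
      Prod.ext (Prod.ext_iff.1 (Finset.mem_filter.1 (hxmem ℓ)).2).1 (hi _ (hx ℓ))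
    have hxs : ∀ ℓ, g (j (x ℓ)) = (s, x ℓ) := fun ℓ =>
      Prod.ext (Prod.ext_iff.1 (Finset.mem_filter.1 (hxmem ℓ)).2).2 (hj _ (hx ℓ))
    have hmono : StrictMono x := x.strictMono
    have himono : StrictMono fun ℓ => i (x ℓ) := fun a b hab => by
      by_contra! hle
      have hlt := hmono hab
      rcases hle.eq_or_lt with he | hlt'
      · have h1 := hi _ (hx a)
        have h2 := hi _ (hx b)
        rw [he] at h2
        omega
      · have h1 := hi' _ (hx b) _ hlt' (hiT _ (hx a))
        rw [hi _ (hx a)] at h1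
        omega
    have hjmono : Antitone fun ℓ => j (x ℓ) := fun a b hab => by
      by_contra! hlt'
      have hle := hmono.monotone hab
      have h1 := hj' _ (hx b) _ (hTj _ (hx a)) hlt'
      rw [hj _ (hx a)] at h1
      omega
    have hrun' : ∀ (ℓ : Fin (m + 1)) (a b : ℕ), i (x ℓ) ≤ a → a ≤ b → b ≤ j (x ℓ) → ∀ k,
        ORun V ((g a).1, k + ((g a).2 - x ℓ)) (slice π a b) ((g b).1, k + ((g b).2 - x ℓ)) := by
      intro ℓ a b ha hab hb k
      have hge : ∀ t, i (x ℓ) ≤ t → t ≤ j (x ℓ) → x ℓ ≤ (g t).2 := fun t h1 h2 => by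
        rcases h1.eq_or_lt with rfl | h1
        · exact (hi _ (hx ℓ)).ge
        rcases h2.eq_or_lt with rfl | h2
        · exact (hj _ (hx ℓ)).ge
        rcases le_total t T with h | h
        · exact (hi' _ (hx ℓ) t h1 h).le
        · exact (hj' _ (hx ℓ) t h h2).le
      refine ORun.of_steps (g := fun t => ((g t).1, k + ((g t).2 - x ℓ))) hab fun t h1 h2 => ?_
      have := hjl _ (hx ℓ)
      refine (hg t (by omega)).translate (hge t (by omega) (by omega))
        (hge _ (by omega) (by omega)) ?_ k
      rcases lt_or_ge t T with h | h
      · have := hi' _ (hx ℓ) (t + 1) (by omega) h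
        omega
      · have := hj' _ (hx ℓ) t h (by omega)
        omega
    have hiT' := fun ℓ => hiT _ (hx ℓ)
    have hTj' := fun ℓ => hTj _ (hx ℓ)
    refine exists_pumpable_of_positions hg himono hjmono ((hiT' _).trans (hTj' _))
      (hjl _ (hx 0)) (Set.mem_univ (x 0)) (hxr 0) (hxs 0)
      (fun ℓ => x ℓ.succ - x ℓ.castSucc) (fun _ _ _ => Set.mem_univ _) ?_ ?_ ?_
    · intro k _
      simpa [hxr, hxs] using hrun' _ _ _ le_rfl ((hiT' (Fin.last m)).trans (hTj' _)) le_rfl k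
    · intro ℓ k _
      simpa [hxr, hxs] using hrun' ℓ.castSucc _ _ le_rfl (himono ℓ.castSucc_lt_succ).le
        ((hiT' _).trans (hTj' _)) k
    · intro ℓ k _
      simpa [hxr, hxs] using hrun' ℓ.castSucc _ _ ((hiT' _).trans (hTj' ℓ.succ))
        (hjmono ℓ.castSucc_lt_succ.le) le_rfl k
  · push Not at hbig
    obtain ⟨⟨r, y⟩, -, hry⟩ := Finset.exists_lt_card_fiber_of_mul_lt_card_of_maps_to
      (s := Finset.range (π.length + 1))
      (t := (Finset.univ : Finset Q) ×ˢ Finset.range (m * n ^ 2)) (f := g) (n := m)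
      (fun t ht => Finset.mem_product.2 ⟨Finset.mem_univ _, Finset.mem_range.2
        (hbig t (Nat.lt_succ_iff.1 (Finset.mem_range.1 ht)))⟩)
      (by
        rw [Finset.card_product, Finset.card_univ, Finset.card_range, Finset.card_range, ← hn]
        exact Nat.lt_succ_of_le (le_trans (by ring_nf; exact le_rfl) hlen))
    let i := Finset.orderEmbOfCardLe _ (Nat.succ_le_of_lt hry)
    have himem := fun ℓ => Finset.orderEmbOfCardLe_mem _ (Nat.succ_le_of_lt hry) ℓ
    have hil : ∀ ℓ, i ℓ ≤ π.length := fun ℓ =>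
      Nat.lt_succ_iff.1 (Finset.mem_range.1 (Finset.mem_filter.1 (himem ℓ)).1)
    have hgi : ∀ ℓ, g (i ℓ) = (r, y) := fun ℓ => (Finset.mem_filter.1 (himem ℓ)).2
    have himono : StrictMono i := i.strictMono
    refine exists_pumpable_of_positions hg himono (j := fun _ => i (Fin.last m))
      (fun _ _ _ => le_rfl) le_rfl (hil _) (Set.mem_singleton y) (hgi _) (hgi _)
      (fun _ => 0) (by simp) ?_ ?_ ?_
    · rintro k -
      rw [slice_self]
      exact .nil _
    · rintro ℓ k rfl
      have := ORun.of_steps (V := V) (π := π) (g := g) (himono ℓ.castSucc_lt_succ).le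
        fun t _ ht => hg t (ht.trans_le (hil _))
      rwa [hgi, hgi] at this
    · rintro ℓ k -
      rw [slice_self]
      exact .nil _

end TVASSpaper
end
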